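/- Let f be a C^r local diffeomorphism of 𝕋², r ≥ 2, of degree d ≥ 2, with C(f) > 0 and inf_{x∈𝕋²} |det Df_x| > 1. There exist ℓ₀ > 0 and η > 0 such that for every C^r local diffeomorphism g of 𝕋² with d_{C²}(f,g) < η and every equidistributed g-invariant Borel probability measure μ: μ({x∈𝕋² : there exists a local stable manifold W^s_g(x) which is a 1-Lipschitz graph with length |W^s_g(x)| > ℓ₀}) > 0. -/

import Mathlib

open MeasureTheory Filter Topology Set
open scoped ENNReal NNReal

noncomputable section


open MeasureTheory Filter Topology Set
open scoped ENNReal NNReal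

noncomputable section

instance fact_zero_lt_one' : Fact ((0:ℝ) < 1) := ⟨one_pos⟩

/-- The plane `ℝ²` with the Euclidean norm: the universal cover of the 2-torus and the
common model of all its tangent spaces. -/
abbrev V2 : Type := EuclideanSpace ℝ (Fin 2)

/-- The flat 2-torus `𝕋² = ℝ²/ℤ²`. -/
abbrev T2 : Type := AddCircle (1 : ℝ) × AddCircle (1 : ℝ)

/-- The covering projection `ℝ² → 𝕋²`. -/
def proj (p : V2) : T2 := (↑(p 0), ↑(p 1))

/-- The integer vector `(m 0, m 1)` as an element of the plane. -/
def iv (m : Fin 2 → ℤ) : V2 := (WithLp.equiv 2 (Fin 2 → ℝ)).symm (fun i => (m i : ℝ))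

/-- A `C^r` local diffeomorphism of the 2-torus, encoded by a `C^r` lift `F : ℝ² → ℝ²`
equivariant with respect to an integer linear part `A`, together with the induced map
`toFun` on the torus and its derivative cocycle `D` (tangent spaces being canonically `ℝ²`);
invertibility of `D` at every point expresses that the map is a local diffeomorphism. -/
structure TorusMap (r : ℕ) : Type where
  F : V2 → V2
  contDiff : ContDiff ℝ r F
  A : Matrix (Fin 2) (Fin 2) ℤ
  equivar : ∀ (p : V2) (m : Fin 2 → ℤ), F (p + iv m) = F p + iv (A.mulVec m)
  toFun : T2 → T2
  toFun_proj : ∀ p : V2, toFun (proj p) = proj (F p)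
  D : T2 → (V2 →L[ℝ] V2)
  D_proj : ∀ p : V2, D (proj p) = fderiv ℝ F p
  isUnit_D : ∀ x : T2, IsUnit (D x)

namespace TorusMap

variable {r : ℕ}

/-- The degree of `f`: the number of preimages of any point, `|det A|`. -/
def deg (f : TorusMap r) : ℕ := f.A.det.natAbs

/-- The derivative of `f^[n]` at `x` (by the chain rule). -/
def Dn (f : TorusMap r) : ℕ → T2 → (V2 →L[ℝ] V2)
  | 0, _ => ContinuousLinearMap.id ℝ V2
  | n + 1, x => (Dn f n (f.toFun x)).comp (f.D x)

/-- The inverse `(Df^n_x)⁻¹` of the derivative of `f^[n]` at `x`. -/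
def Dninv (f : TorusMap r) (n : ℕ) (x : T2) : V2 →L[ℝ] V2 := Ring.inverse (f.Dn n x)

/-- `I(x,v;fⁿ) = d^{-n} ∑_{y ∈ f^{-n}(x)} log ‖(Dfⁿ_y)⁻¹ · v‖`. -/
def I (f : TorusMap r) (x : T2) (v : V2) (n : ℕ) : ℝ :=
  ((f.deg : ℝ) ^ n)⁻¹ * ∑ᶠ y ∈ (f.toFun^[n]) ⁻¹' {x}, Real.log ‖f.Dninv n y v‖

/-- `inf_{(x,v) ∈ T¹𝕋²} I(x,v;fⁿ)`. -/
def unifInf (f : TorusMap r) (n : ℕ) : ℝ :=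
  ⨅ xv : T2 × Metric.sphere (0 : V2) 1, f.I xv.1 (xv.2 : V2) n

/-- `C(f) = liminf_{n→∞} (1/n) inf_{(x,v) ∈ T¹𝕋²} I(x,v;fⁿ)`. -/
def C (f : TorusMap r) : ℝ := Filter.liminf (fun n : ℕ => f.unifInf n / n) Filter.atTop

/-- `I_f(x) = limsup_{n→∞} (1/n) inf_{v ∈ T¹_x𝕋²} I(x,v;fⁿ)`. -/
def Isup (f : TorusMap r) (x : T2) : ℝ :=
  Filter.limsup (fun n : ℕ => (⨅ v : Metric.sphere (0 : V2) 1, f.I x (v : V2) n) / n)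
    Filter.atTop

/-- The determinant of the derivative of `f` at `x`. -/
def detD (f : TorusMap r) (x : T2) : ℝ := LinearMap.det (f.D x : V2 →ₗ[ℝ] V2)

/-- `μ` is an `f`-invariant measure. -/
def Invariant (f : TorusMap r) (μ : Measure T2) : Prop :=
  ∀ s : Set T2, MeasurableSet s → μ (f.toFun ⁻¹' s) = μ s

/-- `μ` is equidistributed: `μ(f(A)) = d·μ(A)` for every Borel set `A` on which `f` is
injective (equivalently, `μ` maximizes the folding entropy: `F_μ(f) = log d`). -/
def Equidistributed (f : TorusMap r) (μ : Measure T2) : Prop :=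
  ∀ s : Set T2, MeasurableSet s → Set.InjOn f.toFun s →
    μ (f.toFun '' s) = (f.deg : ℝ≥0∞) * μ s

end TorusMap

/-- The minimal norm (conorm) of a linear map of the plane. -/
def minNorm (L : V2 →L[ℝ] V2) : ℝ := ⨅ v : Metric.sphere (0 : V2) 1, ‖L (v : V2)‖

/-- `ω` is a backward orbit of `x` under `f`. -/
def IsBackward {r : ℕ} (f : TorusMap r) (x : T2) (ω : ℕ → T2) : Prop :=
  ω 0 = x ∧ ∀ k, f.toFun (ω (k + 1)) = ω k

/-- The space of backward orbits of `x` under `f`. -/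
abbrev Bw {r : ℕ} (f : TorusMap r) (x : T2) : Type := {ω : ℕ → T2 // IsBackward f x ω}

/-- `p` is the uniformly distributed (Bernoulli) measure on the backward orbits of `x`:
each of the `dⁿ` preimages `z ∈ f^{-n}(x)` carries mass `d^{-n}`. -/
def IsBernoulliBw {r : ℕ} (f : TorusMap r) (x : T2) (p : Measure (Bw f x)) : Prop :=
  IsProbabilityMeasure p ∧
    ∀ (n : ℕ) (z : T2), f.toFun^[n] z = x →
      p {ω : Bw f x | ω.1 n = z} = ((f.deg : ℝ≥0∞) ^ n)⁻¹

/-- The `C^k` distance between two torus maps: sup distance between the values plus the sup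
norms of the differences of the derivatives up to order `k`, computed via the lifts. -/
def distC {r : ℕ} (k : ℕ) (f g : TorusMap r) : ℝ :=
  (⨆ x : T2, dist (f.toFun x) (g.toFun x)) +
    ∑ i ∈ Finset.Icc 1 k, ⨆ p : V2, ‖iteratedFDeriv ℝ i f.F p - iteratedFDeriv ℝ i g.F p‖

/-- The length of the curve `σ` (parametrized on `[-1,1]`). -/
def clen (σ : ℝ → V2) : ℝ := ∫ t in (-1 : ℝ)..1, ‖deriv σ t‖

open scoped RealInnerProductSpace

/-- `σ` is an `L`-Lipschitz graph centered at `x = σ(s₀)`: in the orthogonal splitting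
`T_x𝕋² = ℝσ'(s₀) ⊕ ℝσ'(s₀)^⊥`, the curve coincides with (the exponential of) the graph of
an `L`-Lipschitz function. -/
def IsLipGraph (L : ℝ≥0) (σ : ℝ → V2) (s₀ : ℝ) : Prop :=
  ∃ (u w : V2) (φ : ℝ → ℝ) (J : Set ℝ),
    ‖u‖ = 1 ∧ ‖w‖ = 1 ∧ ⟪u, w⟫ = 0 ∧ (∃ c : ℝ, 0 < c ∧ deriv σ s₀ = c • u) ∧
    LipschitzOnWith L φ J ∧
    σ '' Set.Icc (-1 : ℝ) 1 = (fun t => σ s₀ + t • u + φ t • w) '' J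

/-- The cone of width `ε` around the direction `v`. -/
def cone (v : V2) (ε : ℝ) : Set V2 := {w | ‖w - ⟪w, v⟫ • v‖ ≤ ε * |⟪w, v⟫|}


/-- `σ` (a planar lift of a curve in `𝕋²`) is a local stable manifold of `g` at `x`:
a `C¹` embedded curve through `x` whose points converge exponentially to the orbit of `x`
under forward iteration. -/
def IsStabMan {r : ℕ} (g : TorusMap r) (x : T2) (σ : ℝ → V2) : Prop :=
  ContDiff ℝ 1 σ ∧ (∀ t ∈ Set.Icc (-1 : ℝ) 1, deriv σ t ≠ 0) ∧
  Set.InjOn (fun t => proj (σ t)) (Set.Icc (-1 : ℝ) 1) ∧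
  ∃ Cc : ℝ, 1 ≤ Cc ∧ ∃ lam : ℝ, 0 < lam ∧
    ∀ s ∈ Set.Icc (-1 : ℝ) 1, ∀ n : ℕ,
      dist (g.toFun^[n] x) (g.toFun^[n] (proj (σ s))) ≤ Cc * Real.exp (-(n : ℝ) * lam)


/-! ### Basic facts on the covering projection -/

lemma ls_proj_continuous : Continuous proj := by
  unfold proj
  refine Continuous.prodMk ?_ ?_
  · exact (AddCircle.continuous_mk' 1).comp (by fun_prop)
  · exact (AddCircle.continuous_mk' 1).comp (by fun_prop)

lemma ls_iv_apply (m : Fin 2 → ℤ) (i : Fin 2) : iv m i = (m i : ℝ) := rfl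

lemma ls_iv_add (m n : Fin 2 → ℤ) : iv (m + n) = iv m + iv n := by
  ext i
  simp [ls_iv_apply]

lemma ls_proj_surj (x : T2) : ∃ p, proj p = x := by
  obtain ⟨a, b⟩ := x
  obtain ⟨a, rfl⟩ := QuotientAddGroup.mk_surjective a
  obtain ⟨b, rfl⟩ := QuotientAddGroup.mk_surjective b
  exact ⟨!₂[a, b], rfl⟩

lemma ls_proj_add_iv (p : V2) (m : Fin 2 → ℤ) : proj (p + iv m) = proj p := by
  unfold proj
  simp only [PiLp.add_apply, ls_iv_apply, AddCircle.coe_add, Prod.mk.injEq]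
  constructor
  · rw [add_eq_left, AddCircle.coe_eq_zero_iff]
    exact ⟨m 0, by simp⟩
  · rw [add_eq_left, AddCircle.coe_eq_zero_iff]
    exact ⟨m 1, by simp⟩

lemma ls_proj_eq {p q : V2} (h : proj p = proj q) : ∃ m, q = p + iv m := by
  unfold proj at h
  simp only [Prod.mk.injEq] at h
  obtain ⟨h0, h1⟩ := h
  rw [← sub_eq_zero, ← AddCircle.coe_sub, AddCircle.coe_eq_zero_iff] at h0 h1
  obtain ⟨a, ha⟩ := h0
  obtain ⟨b, hb⟩ := h1
  refine ⟨![-a, -b], ?_⟩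
  ext i
  fin_cases i
  · simp [ls_iv_apply] at *; linarith
  · simp [ls_iv_apply] at *; linarith

lemma ls_coord_le (v : V2) (i : Fin 2) : |v i| ≤ ‖v‖ := by
  have := PiLp.norm_apply_le v i
  simpa using this

lemma ls_norm_le (v : V2) : ‖v‖ ≤ |v 0| + |v 1| := by
  rw [EuclideanSpace.norm_eq, Fin.sum_univ_two]
  apply Real.sqrt_le_iff.mpr
  constructor
  · positivity
  · simp only [Real.norm_eq_abs]
    nlinarith [abs_nonneg (v 0), abs_nonneg (v 1)]

lemma ls_proj_dist (p q : V2) : dist (proj p) (proj q) ≤ ‖p - q‖ := by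
  rw [Prod.dist_eq]
  unfold proj
  apply max_le
  · rw [dist_eq_norm, ← AddCircle.coe_sub]
    refine (QuotientAddGroup.norm_mk_le_norm).trans ?_
    exact ls_coord_le (p - q) 0
  · rw [dist_eq_norm, ← AddCircle.coe_sub]
    refine (QuotientAddGroup.norm_mk_le_norm).trans ?_
    exact ls_coord_le (p - q) 1

lemma ls_circle_lift (a : AddCircle (1:ℝ)) : ∃ t : ℝ, (t : AddCircle (1:ℝ)) = a ∧ |t| = ‖a‖ := by
  obtain ⟨s, rfl⟩ := QuotientAddGroup.mk_surjective a
  refine ⟨s - round s, ?_, ?_⟩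
  · rw [AddCircle.coe_sub, sub_eq_self, AddCircle.coe_eq_zero_iff]
    exact ⟨round s, by simp⟩
  · have := AddCircle.norm_eq (p := 1) (x := s)
    simp at this
    exact this.symm

lemma ls_lift_near (p : V2) (x : T2) : ∃ q, proj q = x ∧ ‖q - p‖ ≤ 2 * dist (proj p) x := by
  obtain ⟨a, ha, ha'⟩ := ls_circle_lift (x.1 - (proj p).1)
  obtain ⟨b, hb, hb'⟩ := ls_circle_lift (x.2 - (proj p).2)
  refine ⟨p + !₂[a, b], ?_, ?_⟩
  · apply Prod.ext
    · change ((p 0 + a : ℝ) : AddCircle (1:ℝ)) = x.1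
      rw [AddCircle.coe_add, ha]; simp [proj]
    · change ((p 1 + b : ℝ) : AddCircle (1:ℝ)) = x.2
      rw [AddCircle.coe_add, hb]; simp [proj]
  · rw [add_sub_cancel_left]
    refine (ls_norm_le _).trans ?_
    have h1 : dist (proj p) x = max ‖x.1 - (proj p).1‖ ‖x.2 - (proj p).2‖ := by
      rw [Prod.dist_eq, dist_comm, dist_eq_norm, dist_comm, dist_eq_norm]
    have e0 : (!₂[a, b] : V2) 0 = a := rfl
    have e1 : (!₂[a, b] : V2) 1 = b := rfl
    rw [e0, e1, h1, ha', hb']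
    linarith [le_max_left ‖x.1 - (proj p).1‖ ‖x.2 - (proj p).2‖,
      le_max_right ‖x.1 - (proj p).1‖ ‖x.2 - (proj p).2‖]

lemma ls_proj_isOpenMap : IsOpenMap proj := by
  intro U hU
  rw [Metric.isOpen_iff]
  rintro _ ⟨p, hp, rfl⟩
  obtain ⟨ε, hε, hb⟩ := Metric.isOpen_iff.1 hU p hp
  refine ⟨ε / 2, by positivity, ?_⟩
  intro x hx
  obtain ⟨q, rfl, hq⟩ := ls_lift_near p x
  refine ⟨q, hb ?_, rfl⟩
  rw [Metric.mem_ball, dist_comm] at hx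
  rw [Metric.mem_ball, dist_eq_norm]
  linarith

lemma ls_proj_quot : IsQuotientMap proj :=
  ls_proj_isOpenMap.isQuotientMap ls_proj_continuous ls_proj_surj

namespace TorusMap

variable {r : ℕ} (g : TorusMap r)

lemma ls_cont_F : Continuous g.F := g.contDiff.continuous

lemma ls_cont : Continuous g.toFun := by
  rw [ls_proj_quot.continuous_iff]
  have : g.toFun ∘ proj = proj ∘ g.F := by
    ext1 p; exact g.toFun_proj p
  rw [this]
  exact ls_proj_continuous.comp g.ls_cont_F

lemma ls_cont_D (hr : 2 ≤ r) : Continuous g.D := by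
  rw [ls_proj_quot.continuous_iff]
  have : g.D ∘ proj = fderiv ℝ g.F := by
    ext1 p; exact g.D_proj p
  rw [this]
  exact g.contDiff.continuous_fderiv (by norm_cast; omega)

lemma ls_diff (hr : 2 ≤ r) : Differentiable ℝ g.F :=
  g.contDiff.differentiable (by norm_cast; omega)

lemma ls_iter_proj (n : ℕ) (p : V2) : g.toFun^[n] (proj p) = proj (g.F^[n] p) := by
  induction n generalizing p with
  | zero => rfl
  | succ n ih => rw [Function.iterate_succ_apply, Function.iterate_succ_apply, toFun_proj, ih]

lemma ls_iter_contDiff (n : ℕ) : ContDiff ℝ r (g.F^[n]) := by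
  induction n with
  | zero => exact contDiff_id
  | succ n ih => rw [Function.iterate_succ]; exact ih.comp g.contDiff

lemma ls_Dn_proj (hr : 2 ≤ r) (n : ℕ) (p : V2) : g.Dn n (proj p) = fderiv ℝ (g.F^[n]) p := by
  induction n generalizing p with
  | zero => simp [Dn]
  | succ n ih =>
    rw [Dn, g.toFun_proj, ih, g.D_proj, Function.iterate_succ, fderiv_comp]
    · exact (g.ls_iter_contDiff n).differentiable (by norm_cast; omega) _
    · exact g.ls_diff hr p

lemma ls_Dn_add (m n : ℕ) (x : T2) :
    g.Dn (n + m) x = (g.Dn n (g.toFun^[m] x)).comp (g.Dn m x) := by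
  induction m generalizing x with
  | zero => rfl
  | succ m ih =>
    rw [← add_assoc, Dn, ih, Dn, Function.iterate_succ_apply]
    rfl

lemma ls_Dn_isUnit (n : ℕ) (x : T2) : IsUnit (g.Dn n x) := by
  induction n generalizing x with
  | zero => exact isUnit_one
  | succ n ih => exact (ih _).mul (g.isUnit_D x)

lemma ls_Dn_inv_left (n : ℕ) (x : T2) (v : V2) : g.Dninv n x (g.Dn n x v) = v := by
  have := Ring.inverse_mul_cancel _ (g.ls_Dn_isUnit n x)
  exact congrArg (fun L : V2 →L[ℝ] V2 => L v) this

lemma ls_Dn_inv_right (n : ℕ) (x : T2) (v : V2) : g.Dn n x (g.Dninv n x v) = v := by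
  have := Ring.mul_inverse_cancel _ (g.ls_Dn_isUnit n x)
  exact congrArg (fun L : V2 →L[ℝ] V2 => L v) this

lemma ls_Dninv_add (m n : ℕ) (x : T2) (v : V2) :
    g.Dninv (n + m) x v = g.Dninv m x (g.Dninv n (g.toFun^[m] x) v) := by
  have h : g.Dn (n + m) x (g.Dninv m x (g.Dninv n (g.toFun^[m] x) v)) = v := by
    rw [ls_Dn_add, ContinuousLinearMap.comp_apply, ls_Dn_inv_right, ls_Dn_inv_right]
  conv_lhs => rw [← h]
  rw [ls_Dn_inv_left]

lemma ls_Dninv_ne (n : ℕ) (x : T2) (v : V2) (hv : v ≠ 0) : g.Dninv n x v ≠ 0 := by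
  intro h
  apply hv
  rw [← g.ls_Dn_inv_right n x v, h, map_zero]

lemma ls_cont_iter (n : ℕ) : Continuous (g.toFun^[n]) := g.ls_cont.iterate n

lemma ls_cont_Dn (hr : 2 ≤ r) (n : ℕ) : Continuous (g.Dn n) := by
  induction n with
  | zero => exact continuous_const
  | succ n ih => exact (ih.comp g.ls_cont).clm_comp (g.ls_cont_D hr)

lemma ls_cont_Dninv (hr : 2 ≤ r) (n : ℕ) : Continuous (g.Dninv n) := by
  rw [continuous_iff_continuousAt]
  intro x
  obtain ⟨u, hu⟩ := g.ls_Dn_isUnit n x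
  have h1 : ContinuousAt (Ring.inverse : (V2 →L[ℝ] V2) → _) (g.Dn n x) := by
    rw [← hu]; exact NormedRing.inverse_continuousAt u
  exact h1.comp (g.ls_cont_Dn hr n).continuousAt

end TorusMap

/-! ### The lift is a homeomorphism; counting preimages -/

lemma ls_bdd_rep : ∃ R : ℝ, ∀ p : V2, ∃ m, ‖p + iv m‖ ≤ R := by
  obtain ⟨R, hR⟩ := (isCompact_univ (X := T2)).isBounded.exists_norm_le
  refine ⟨2 * R, fun p => ?_⟩
  obtain ⟨q, hq, hq'⟩ := ls_lift_near 0 (proj p)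
  obtain ⟨m, hm⟩ := ls_proj_eq hq.symm
  refine ⟨m, ?_⟩
  rw [← hm]
  have h0 : proj 0 = 0 := rfl
  rw [h0, dist_zero_left, sub_zero] at hq'
  have := hR (proj p) (mem_univ _)
  linarith

lemma ls_periodic_bdd {E : Type*} [NormedAddCommGroup E] (φ : V2 → E) (hc : Continuous φ)
    (hp : ∀ p m, φ (p + iv m) = φ p) : ∃ B : ℝ, ∀ p, ‖φ p‖ ≤ B := by
  obtain ⟨R, hR⟩ := ls_bdd_rep
  obtain ⟨B, hB⟩ := (isCompact_closedBall (0 : V2) R).exists_bound_of_continuousOn hc.continuousOn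
  refine ⟨B, fun p => ?_⟩
  obtain ⟨m, hm⟩ := hR p
  rw [← hp p m]
  exact hB _ (by simpa using hm)

/-- The linear part as a continuous linear map. -/
def lsAL (A : Matrix (Fin 2) (Fin 2) ℤ) : V2 →L[ℝ] V2 :=
  Matrix.toEuclideanCLM (n := Fin 2) (𝕜 := ℝ) (A.map (Int.cast : ℤ → ℝ))

lemma lsAL_iv (A : Matrix (Fin 2) (Fin 2) ℤ) (m : Fin 2 → ℤ) : lsAL A (iv m) = iv (A.mulVec m) := by
  ext i
  rw [ls_iv_apply]
  unfold lsAL iv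
  simp [Matrix.mulVec, dotProduct]
  fin_cases i <;> rfl

lemma lsAL_inv (A : Matrix (Fin 2) (Fin 2) ℤ) (h : A.det ≠ 0) :
    ∃ B : V2 →L[ℝ] V2, ∀ p, B (lsAL A p) = p := by
  refine ⟨Matrix.toEuclideanCLM (n := Fin 2) (𝕜 := ℝ) (A.map (Int.cast : ℤ → ℝ))⁻¹, fun p => ?_⟩
  have hu : IsUnit (A.map (Int.cast : ℤ → ℝ)).det := by
    rw [isUnit_iff_ne_zero]
    have : (A.map (Int.cast : ℤ → ℝ)).det = ((A.det : ℤ) : ℝ) := by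
      simp [Matrix.det_fin_two]
    rw [this]
    exact_mod_cast h
  have h1 := Matrix.nonsing_inv_mul _ hu
  have h2 := congrArg (Matrix.toEuclideanCLM (n := Fin 2) (𝕜 := ℝ)) h1
  rw [map_mul, map_one] at h2
  exact congrArg (fun L : V2 →L[ℝ] V2 => L p) h2

namespace TorusMap

variable {r : ℕ} (g : TorusMap r)

lemma ls_dist_AL : ∃ B : ℝ, ∀ p, ‖g.F p - lsAL g.A p‖ ≤ B := by
  apply ls_periodic_bdd
  · exact g.ls_cont_F.sub (lsAL g.A).continuous
  · intro p m
    rw [g.equivar, map_add, lsAL_iv]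
    abel

lemma ls_proper (h : g.A.det ≠ 0) : IsProperMap g.F := by
  rw [isProperMap_iff_tendsto_cocompact]
  refine ⟨g.ls_cont_F, ?_⟩
  obtain ⟨B, hB⟩ := g.ls_dist_AL
  obtain ⟨L, hL⟩ := lsAL_inv g.A h
  rw [← Metric.cobounded_eq_cocompact, ← comap_norm_atTop, tendsto_comap_iff]
  have key : ∀ p, ‖p‖ ≤ (‖L‖ + 1) * (‖g.F p‖ + B) := by
    intro p
    have h1 : ‖p‖ ≤ ‖L‖ * ‖lsAL g.A p‖ := by
      conv_lhs => rw [← hL p]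
      exact L.le_opNorm _
    have h2 : ‖lsAL g.A p‖ ≤ ‖g.F p‖ + B := by
      have := norm_sub_le (g.F p) (g.F p - lsAL g.A p)
      rw [sub_sub_cancel] at this
      linarith [hB p]
    have h3 := norm_nonneg L
    have h4 := norm_nonneg (lsAL g.A p)
    nlinarith
  have h5 : Tendsto (fun p : V2 => ‖p‖ / (‖L‖ + 1) - B) (comap norm atTop) atTop := by
    have : Tendsto (fun s : ℝ => s / (‖L‖ + 1) - B) atTop atTop := by
      apply tendsto_atTop_add_const_right
      exact tendsto_id.atTop_div_const (by positivity)
    exact this.comp tendsto_comap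
  refine tendsto_atTop_mono (fun p => ?_) h5
  have := key p
  rw [Function.comp_apply, sub_le_iff_le_add, div_le_iff₀ (by positivity)]
  linarith

/-- The derivative of the lift as a linear equivalence. -/
def lsDE (p : V2) : V2 ≃L[ℝ] V2 := ContinuousLinearEquiv.ofUnit (g.isUnit_D (proj p)).unit

lemma ls_hasFDeriv (hr : 2 ≤ r) (p : V2) :
    HasFDerivAt g.F (g.lsDE p : V2 →L[ℝ] V2) p := by
  have : (g.lsDE p : V2 →L[ℝ] V2) = fderiv ℝ g.F p := by
    rw [← g.D_proj]; rfl
  rw [this]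
  exact (g.ls_diff hr p).hasFDerivAt

lemma ls_localHomeo (hr : 2 ≤ r) : IsLocalHomeomorph g.F := by
  intro p
  have h1 : ContDiffAt ℝ r g.F p := g.contDiff.contDiffAt
  refine ⟨h1.toOpenPartialHomeomorph g.F (g.ls_hasFDeriv hr p) (by norm_cast; omega), ?_, ?_⟩
  · exact h1.mem_toOpenPartialHomeomorph_source _ _
  · rfl

lemma ls_covering (hr : 2 ≤ r) (h : g.A.det ≠ 0) : IsCoveringMap g.F := by
  rw [isCoveringMap_iff_isCoveringMapOn_univ]
  have hp := g.ls_proper h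
  refine hp.isClosedMap.isCoveringMapOn_of_isLocalHomeomorphOn (fun x _ => ?_) ?_
  · have hc : IsCompact (g.F ⁻¹' {x}) := hp.isCompact_preimage isCompact_singleton
    apply hc.finite
    refine IsDiscrete.of_openPartialHomeomorph g.F (x := x) subset_rfl ?_
    intro e _
    obtain ⟨φ, h1, h2⟩ := g.ls_localHomeo hr e
    exact ⟨φ, h1, h2.symm⟩
  · exact (g.ls_localHomeo hr).isLocalHomeomorphOn

lemma ls_exists_homeo (hr : 2 ≤ r) (h : g.A.det ≠ 0) : ∃ H : V2 ≃ₜ V2, ∀ p, H p = g.F p := by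
  have cov := g.ls_covering hr h
  obtain ⟨S, ⟨hS0, hS⟩, -⟩ := cov.existsUnique_continuousMap_lifts (ContinuousMap.id V2) (g.F 0) 0 rfl
  have h1 : ∀ q, g.F (S q) = q := fun q => congrFun hS q
  have h2 : S ∘ g.F = id := by
    refine cov.eq_of_comp_eq (S.continuous.comp g.ls_cont_F) continuous_id ?_ 0 ?_
    · ext1 p; simp [h1]
    · simp [hS0]
  exact ⟨{ toFun := g.F, invFun := S, left_inv := fun p => congrFun h2 p, right_inv := h1,
           continuous_toFun := g.ls_cont_F, continuous_invFun := S.continuous }, fun p => rfl⟩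

/-- The inverse of the lift: existence with smoothness. -/
lemma ls_exists_inv (hr : 2 ≤ r) (h : g.A.det ≠ 0) :
    ∃ S : V2 → V2, ContDiff ℝ r S ∧ (∀ p, S (g.F p) = p) ∧ ∀ p, g.F (S p) = p := by
  obtain ⟨H, hH⟩ := g.ls_exists_homeo hr h
  have hH' : (H : V2 → V2) = g.F := funext hH
  refine ⟨H.symm, ?_, fun p => ?_, fun p => ?_⟩
  · apply H.contDiff_symm (f₀' := g.lsDE)
    · rw [hH']; exact g.ls_hasFDeriv hr
    · rw [hH']; exact g.contDiff
  · rw [← hH]; simp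
  · rw [← hH]; simp

lemma ls_card_quot (A : Matrix (Fin 2) (Fin 2) ℤ) (h : A.det ≠ 0) :
    Nat.card ((Fin 2 → ℤ) ⧸ LinearMap.range A.mulVecLin) = A.det.natAbs := by
  have hinj : Function.Injective A.mulVecLin := by
    rw [← LinearMap.ker_eq_bot, LinearMap.ker_eq_bot']
    intro v hv
    exact Matrix.eq_zero_of_mulVec_eq_zero h hv
  have := Submodule.natAbs_det_equiv (LinearMap.range A.mulVecLin)
    (LinearEquiv.ofInjective A.mulVecLin hinj)
  rw [← this]
  congr 1
  have h2 : (LinearMap.range A.mulVecLin).subtype ∘ₗ AddMonoidHom.toIntLinearMap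
      ((LinearEquiv.ofInjective A.mulVecLin hinj : (Fin 2 → ℤ) ≃ₗ[ℤ] _) : (Fin 2 → ℤ) →+ _)
      = Matrix.toLin' A := by
    ext i; rfl
  rw [h2, LinearMap.det_toLin']

lemma ls_fiber (hr : 2 ≤ r) (h : g.A.det ≠ 0) (x : T2) :
    (g.toFun ⁻¹' {x}).Finite ∧ (g.toFun ⁻¹' {x}).ncard ≤ g.deg := by
  obtain ⟨S, -, hS1, hS2⟩ := g.ls_exists_inv hr h
  obtain ⟨q, rfl⟩ := ls_proj_surj x
  have hc := ls_card_quot g.A h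
  have hfin : Finite ((Fin 2 → ℤ) ⧸ LinearMap.range g.A.mulVecLin) := by
    apply Nat.finite_of_card_ne_zero
    rw [hc]
    simpa using h
  have hsub : g.toFun ⁻¹' {proj q} ⊆
      range (fun c : (Fin 2 → ℤ) ⧸ LinearMap.range g.A.mulVecLin => proj (S (q + iv c.out))) := by
    intro y hy
    obtain ⟨p, rfl⟩ := ls_proj_surj y
    have hy' : proj q = proj (g.F p) := by rw [← g.toFun_proj]; exact hy.symm
    obtain ⟨m, hm⟩ := ls_proj_eq hy'
    refine ⟨Submodule.Quotient.mk m, ?_⟩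
    have h1 : (Submodule.Quotient.mk (Quotient.out (Submodule.Quotient.mk m :
        (Fin 2 → ℤ) ⧸ LinearMap.range g.A.mulVecLin)) : (Fin 2 → ℤ) ⧸ LinearMap.range g.A.mulVecLin)
        = Submodule.Quotient.mk m := Quotient.out_eq _
    rw [Submodule.Quotient.eq] at h1
    obtain ⟨k, hk⟩ := h1
    have hk' : Quotient.out (Submodule.Quotient.mk m :
        (Fin 2 → ℤ) ⧸ LinearMap.range g.A.mulVecLin) = m + g.A.mulVec k := by
      rw [← sub_eq_iff_eq_add']; exact hk.symm
    change proj (S (q + iv (Quotient.out _))) = _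
    rw [hk', ls_iv_add, ← add_assoc, ← hm, ← g.equivar, hS1, ls_proj_add_iv]
  refine ⟨(finite_range _).subset hsub, ?_⟩
  calc _ ≤ (range (fun c : (Fin 2 → ℤ) ⧸ LinearMap.range g.A.mulVecLin =>
        proj (S (q + iv c.out)))).ncard := ncard_le_ncard hsub (finite_range _)
    _ ≤ Nat.card ((Fin 2 → ℤ) ⧸ LinearMap.range g.A.mulVecLin) := by
        rw [← image_univ, ← Set.ncard_univ]
        exact ncard_image_le (toFinite _)
    _ = g.deg := hc

lemma ls_fiber_iter (hr : 2 ≤ r) (h : g.A.det ≠ 0) (n : ℕ) (x : T2) :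
    ((g.toFun^[n]) ⁻¹' {x}).Finite ∧ ((g.toFun^[n]) ⁻¹' {x}).ncard ≤ g.deg ^ n := by
  classical
  induction n with
  | zero => simp
  | succ n ih =>
    obtain ⟨hf, hc⟩ := ih
    have hsub : (g.toFun^[n+1]) ⁻¹' {x} ⊆
        (hf.toFinset.biUnion fun y => (g.ls_fiber hr h y).1.toFinset : Finset T2) := by
      intro z hz
      simp only [Finset.coe_biUnion, mem_iUnion]
      refine ⟨g.toFun z, ?_, ?_⟩
      · simpa using hz
      · simp
    refine ⟨(Finset.finite_toSet _).subset hsub, ?_⟩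
    refine (ncard_le_ncard hsub (Finset.finite_toSet _)).trans ?_
    rw [ncard_coe_finset, pow_succ]
    refine (Finset.card_biUnion_le_card_mul _ _ g.deg ?_).trans ?_
    · intro y _
      rw [← ncard_eq_toFinset_card _ (g.ls_fiber hr h y).1]
      exact (g.ls_fiber hr h y).2
    · rw [← ncard_eq_toFinset_card _ hf]
      exact Nat.mul_le_mul_right _ hc

end TorusMap

/-! ### Uniform constants in a neighbourhood -/

/-- Uniform bounds for a torus map. -/
structure LsNice {r : ℕ} (M : ℝ) (g : TorusMap r) : Prop where
  one_le : 1 ≤ M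
  upper : ∀ x v, ‖g.D x v‖ ≤ M * ‖v‖
  lower : ∀ x v, ‖v‖ ≤ M * ‖g.D x v‖
  det : ∀ x, 1 ≤ |g.detD x|
  second : ∀ p, ‖fderiv ℝ (fderiv ℝ g.F) p‖ ≤ M

namespace TorusMap

variable {r : ℕ} (f g : TorusMap r)

lemma ls_norm_it1 (p : V2) : ‖iteratedFDeriv ℝ 1 g.F p‖ = ‖fderiv ℝ g.F p‖ := by
  have := norm_iteratedFDeriv_fderiv (𝕜 := ℝ) (f := g.F) (x := p) (n := 0)
  rw [← this]; simp

lemma ls_norm_it2 (p : V2) : ‖iteratedFDeriv ℝ 2 g.F p‖ = ‖fderiv ℝ (fderiv ℝ g.F) p‖ := by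
  have h1 := norm_iteratedFDeriv_fderiv (𝕜 := ℝ) (f := g.F) (x := p) (n := 1)
  have h2 := norm_iteratedFDeriv_fderiv (𝕜 := ℝ) (f := fderiv ℝ g.F) (x := p) (n := 0)
  rw [← h1, ← h2]; simp

lemma ls_bdd1 (hr : 2 ≤ r) : ∃ B : ℝ, ∀ p, ‖fderiv ℝ g.F p‖ ≤ B := by
  apply ls_periodic_bdd
  · exact g.contDiff.continuous_fderiv (by norm_cast; omega)
  · intro p m
    rw [← g.D_proj, ← g.D_proj, ls_proj_add_iv]

lemma ls_bdd2 (hr : 2 ≤ r) : ∃ B : ℝ, ∀ p, ‖fderiv ℝ (fderiv ℝ g.F) p‖ ≤ B := by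
  refine ls_periodic_bdd (E := V2 →L[ℝ] V2 →L[ℝ] V2) (fderiv ℝ (fderiv ℝ g.F)) ?_ ?_
  · have h1 : ContDiff ℝ 1 (fderiv ℝ g.F) := g.contDiff.fderiv_right (by norm_cast)
    exact h1.continuous_fderiv (by norm_num)
  · intro p m
    have : fderiv ℝ g.F = fun p => fderiv ℝ g.F (p + iv m) := by
      ext1 p
      rw [← g.D_proj, ← g.D_proj, ls_proj_add_iv]
    conv_rhs => rw [this]
    rw [fderiv_comp_add_right]

lemma ls_distC (hr : 2 ≤ r) {η : ℝ} (h : distC 2 f g < η) :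
    (∀ x, dist (f.toFun x) (g.toFun x) ≤ η) ∧ (∀ x, ‖f.D x - g.D x‖ ≤ η) ∧
    (∀ p, ‖fderiv ℝ (fderiv ℝ g.F) p‖ ≤ ‖fderiv ℝ (fderiv ℝ f.F) p‖ + η) := by
  unfold distC at h
  have hI : Finset.Icc 1 2 = ({1, 2} : Finset ℕ) := by decide
  rw [hI, Finset.sum_pair (by norm_num)] at h
  obtain ⟨R, hR⟩ := (isCompact_univ (X := T2)).isBounded.exists_norm_le
  obtain ⟨a1, ha1⟩ := f.ls_bdd1 hr
  obtain ⟨a2, ha2⟩ := f.ls_bdd2 hr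
  obtain ⟨b1, hb1⟩ := g.ls_bdd1 hr
  obtain ⟨b2, hb2⟩ := g.ls_bdd2 hr
  have B0 : BddAbove (range fun x : T2 => dist (f.toFun x) (g.toFun x)) := by
    refine ⟨R + R, ?_⟩
    rintro _ ⟨x, rfl⟩
    exact (dist_le_norm_add_norm _ _).trans (add_le_add (hR _ (mem_univ _)) (hR _ (mem_univ _)))
  have B1 : BddAbove (range fun p : V2 => ‖iteratedFDeriv ℝ 1 f.F p - iteratedFDeriv ℝ 1 g.F p‖) := by
    refine ⟨a1 + b1, ?_⟩
    rintro _ ⟨x, rfl⟩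
    refine (norm_sub_le _ _).trans ?_
    rw [ls_norm_it1, ls_norm_it1]
    exact add_le_add (ha1 _) (hb1 _)
  have B2 : BddAbove (range fun p : V2 => ‖iteratedFDeriv ℝ 2 f.F p - iteratedFDeriv ℝ 2 g.F p‖) := by
    refine ⟨a2 + b2, ?_⟩
    rintro _ ⟨x, rfl⟩
    refine (norm_sub_le _ _).trans ?_
    rw [ls_norm_it2, ls_norm_it2]
    exact add_le_add (ha2 _) (hb2 _)
  have n0 : 0 ≤ ⨆ x : T2, dist (f.toFun x) (g.toFun x) := Real.iSup_nonneg fun _ => dist_nonneg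
  have n1 : 0 ≤ ⨆ p : V2, ‖iteratedFDeriv ℝ 1 f.F p - iteratedFDeriv ℝ 1 g.F p‖ :=
    Real.iSup_nonneg fun _ => norm_nonneg _
  have n2 : 0 ≤ ⨆ p : V2, ‖iteratedFDeriv ℝ 2 f.F p - iteratedFDeriv ℝ 2 g.F p‖ :=
    Real.iSup_nonneg fun _ => norm_nonneg _
  refine ⟨fun x => ?_, fun x => ?_, fun p => ?_⟩
  · have := le_ciSup B0 x
    linarith
  · obtain ⟨p, rfl⟩ := ls_proj_surj x
    have h1 := le_ciSup B1 p
    apply ContinuousLinearMap.opNorm_le_bound _ (by linarith)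
    intro v
    have h2 := (iteratedFDeriv ℝ 1 f.F p - iteratedFDeriv ℝ 1 g.F p).le_opNorm (fun _ => v)
    simp only [ContinuousMultilinearMap.sub_apply, iteratedFDeriv_one_apply] at h2
    rw [f.D_proj, g.D_proj, ContinuousLinearMap.sub_apply]
    refine h2.trans ?_
    simp only [Finset.prod_const, Finset.card_univ, Fintype.card_fin, pow_one]
    exact mul_le_mul_of_nonneg_right (by linarith) (norm_nonneg _)
  · have h1 := le_ciSup B2 p
    rw [← ls_norm_it2, ← ls_norm_it2]
    have := norm_sub_norm_le (iteratedFDeriv ℝ 2 g.F p) (iteratedFDeriv ℝ 2 f.F p)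
    rw [norm_sub_rev] at this
    linarith

lemma ls_A_eq (hr : 2 ≤ r) {η : ℝ} (hη : η < 1) (h : ∀ x, ‖f.D x - g.D x‖ ≤ η) : g.A = f.A := by
  have hmv : ∀ p q : V2, ‖(f.F q - g.F q) - (f.F p - g.F p)‖ ≤ η * ‖q - p‖ := by
    intro p q
    refine Convex.norm_image_sub_le_of_norm_hasFDerivWithin_le (s := univ)
      (f := fun q => f.F q - g.F q) (f' := fun q => fderiv ℝ f.F q - fderiv ℝ g.F q)
      ?_ ?_ convex_univ (mem_univ _) (mem_univ _)
    · intro z _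
      exact ((f.ls_diff hr z).hasFDerivAt.sub (g.ls_diff hr z).hasFDerivAt).hasFDerivWithinAt
    · intro z _
      rw [← f.D_proj, ← g.D_proj]
      exact h _
  ext i j
  have h1 := hmv 0 (0 + iv (Pi.single j 1))
  rw [f.equivar, g.equivar] at h1
  have h2 : f.F 0 + iv (f.A.mulVec (Pi.single j 1)) - (g.F 0 + iv (g.A.mulVec (Pi.single j 1))) -
      (f.F 0 - g.F 0) = iv (f.A.mulVec (Pi.single j 1)) - iv (g.A.mulVec (Pi.single j 1)) := by abel
  rw [h2, add_sub_cancel_left] at h1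
  have h3 : ‖iv (Pi.single j 1)‖ = 1 := by
    have : iv (Pi.single j 1) = EuclideanSpace.single j (1:ℝ) := by
      ext k
      rw [ls_iv_apply]
      by_cases hk : k = j
      · subst hk; simp
      · simp [hk]
    rw [this]; simp
  rw [h3, mul_one] at h1
  have h4 := (ls_coord_le _ i).trans h1
  simp only [PiLp.sub_apply, ls_iv_apply, Matrix.mulVec_single_one, Matrix.col_apply] at h4
  have h5 : |f.A i j - g.A i j| < 1 := by
    have : |((f.A i j - g.A i j : ℤ) : ℝ)| < 1 := by push_cast; linarith
    exact_mod_cast this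
  rw [Int.abs_lt_one_iff] at h5
  omega

lemma ls_nbhd (hr : 2 ≤ r) (hdet : 1 < ⨅ x : T2, |f.detD x|) :
    ∃ M : ℝ, ∃ η : ℝ, 0 < η ∧ ∀ g : TorusMap r, distC 2 f g < η → LsNice M g ∧ g.A = f.A := by
  obtain ⟨a1, ha1⟩ := f.ls_bdd1 hr
  obtain ⟨a2, ha2⟩ := f.ls_bdd2 hr
  obtain ⟨a3, ha3⟩ := (isCompact_univ (X := T2)).exists_bound_of_continuousOn
    (f.ls_cont_Dninv hr 1).continuousOn
  have hd : ∀ x, 1 < |f.detD x| := fun x =>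
    hdet.trans_le (ciInf_le ⟨0, by rintro _ ⟨y, rfl⟩; exact abs_nonneg _⟩ x)
  have hU : IsOpen {L : V2 →L[ℝ] V2 | 1 < |L.det|} :=
    isOpen_lt continuous_const ContinuousLinearMap.continuous_det.abs
  have hK : IsCompact (range f.D) := isCompact_range (f.ls_cont_D hr)
  obtain ⟨δ, hδ, hsub⟩ := hK.exists_thickening_subset_open hU (by
    rintro _ ⟨x, rfl⟩; exact hd x)
  have ha1' : 0 ≤ a1 := (norm_nonneg _).trans (ha1 0)
  have ha2' : 0 ≤ a2 := (norm_nonneg (fderiv ℝ (fderiv ℝ f.F) 0)).trans (ha2 0)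
  have ha3' : 0 ≤ a3 := (norm_nonneg _).trans (ha3 0 (mem_univ _))
  have hinv : ∀ x v, ‖v‖ ≤ a3 * ‖f.D x v‖ := by
    intro x v
    have h1 : f.Dn 1 x v = f.D x v := rfl
    have := f.ls_Dn_inv_left 1 x v
    conv_lhs => rw [← this, h1]
    exact (ContinuousLinearMap.le_opNorm _ _).trans
      (mul_le_mul_of_nonneg_right (ha3 x (mem_univ _)) (norm_nonneg _))
  have hη : 0 < min (min (1/2) (δ/2)) (1 / (2 * (a3 + 1))) := by positivity
  obtain ⟨η, hη, hη1, hη2, hη3⟩ : ∃ η : ℝ, 0 < η ∧ η ≤ 1/2 ∧ η ≤ δ/2 ∧ η ≤ 1 / (2 * (a3 + 1)) :=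
    ⟨_, hη, (min_le_left _ _).trans (min_le_left _ _), (min_le_left _ _).trans (min_le_right _ _),
      min_le_right _ _⟩
  refine ⟨a1 + a2 + 2 * a3 + 1, η, hη, ?_⟩
  intro g hg
  obtain ⟨-, hD, h2⟩ := f.ls_distC g hr hg
  refine ⟨⟨by linarith, ?_, ?_, ?_, ?_⟩, f.ls_A_eq g hr (by linarith) hD⟩
  · intro x v
    obtain ⟨p, rfl⟩ := ls_proj_surj x
    refine (ContinuousLinearMap.le_opNorm _ _).trans
      (mul_le_mul_of_nonneg_right ?_ (norm_nonneg _))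
    have := norm_sub_norm_le (g.D (proj p)) (f.D (proj p))
    rw [norm_sub_rev] at this
    have h3 := hD (proj p)
    have h4 := ha1 p
    rw [← f.D_proj] at h4
    linarith
  · intro x v
    have h3 := hinv x v
    have h4 : ‖f.D x v‖ ≤ ‖g.D x v‖ + η * ‖v‖ := by
      have h5 := (f.D x - g.D x).le_opNorm v
      have h6 := norm_sub_norm_le (f.D x v) (g.D x v)
      rw [ContinuousLinearMap.sub_apply] at h5
      have := mul_le_mul_of_nonneg_right (hD x) (norm_nonneg v)
      linarith
    have h5 : a3 * η ≤ 1/2 := by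
      rw [le_div_iff₀ (by positivity)] at hη3
      nlinarith
    have h6 : ‖v‖ ≤ a3 * ‖g.D x v‖ + 1/2 * ‖v‖ := by
      have := mul_le_mul_of_nonneg_left h4 ha3'
      have := mul_le_mul_of_nonneg_right h5 (norm_nonneg v)
      nlinarith
    have h7 := norm_nonneg (g.D x v)
    nlinarith [mul_nonneg ha1' h7, mul_nonneg ha2' h7]
  · intro x
    apply le_of_lt
    have hmem : g.D x ∈ Metric.thickening δ (range f.D) := ?_
    · exact hsub hmem
    rw [Metric.mem_thickening_iff]
    refine ⟨f.D x, ⟨x, rfl⟩, ?_⟩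
    rw [dist_comm, dist_eq_norm]
    linarith [hD x]
  · intro p
    linarith [h2 p, ha2 p]

end TorusMap

/-! ### The fibre expectation -/

namespace TorusMap

variable {r : ℕ} (f g : TorusMap r)

lemma ls_log_bdd (hr : 2 ≤ r) (n : ℕ) :
    ∃ B : ℝ, 1 ≤ B ∧ ∀ y v, ‖v‖ = 1 → |Real.log ‖f.Dninv n y v‖| ≤ B := by
  have hc : Continuous fun z : T2 × Metric.sphere (0 : V2) 1 =>
      Real.log ‖f.Dninv n z.1 (z.2 : V2)‖ := by
    apply Continuous.log
    · exact (((f.ls_cont_Dninv hr n).comp continuous_fst).clm_apply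
        (continuous_subtype_val.comp continuous_snd)).norm
    · intro z
      have hz : (z.2 : V2) ≠ 0 := by
        intro h0
        have := mem_sphere_zero_iff_norm.1 z.2.2
        rw [h0] at this; simp at this
      exact norm_ne_zero_iff.2 (f.ls_Dninv_ne n z.1 _ hz)
  obtain ⟨B, hB⟩ := isCompact_univ.exists_bound_of_continuousOn hc.continuousOn
  refine ⟨max B 1, le_max_right _ _, fun y v hv => ?_⟩
  have := hB (y, ⟨v, mem_sphere_zero_iff_norm.2 hv⟩) (mem_univ _)
  exact this.trans (le_max_left _ _)

lemma ls_C_pos (hC : 0 < f.C) : ∃ N : ℕ, 1 ≤ N ∧ ∃ c : ℝ, 0 < c ∧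
    ∀ x v, ‖v‖ = 1 → c ≤ f.I x v N := by
  unfold C at hC
  rw [Filter.liminf_eq] at hC
  have : ∃ a ∈ {a | ∀ᶠ n : ℕ in atTop, a ≤ f.unifInf n / n}, 0 < a := by
    by_contra! hcon
    exact absurd hC (not_lt.2 (Real.sSup_nonpos hcon))
  obtain ⟨a, ha, ha0⟩ := this
  obtain ⟨N, hN, hN1⟩ := (Filter.Eventually.and ha (eventually_ge_atTop 1)).exists
  have hNr : (0:ℝ) < N := by exact_mod_cast hN1
  have hpos : 0 < f.unifInf N := by
    rw [le_div_iff₀ hNr] at hN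
    exact lt_of_lt_of_le (by positivity) hN
  refine ⟨N, hN1, f.unifInf N, hpos, fun x v hv => ?_⟩
  have hb : BddBelow (range fun xv : T2 × Metric.sphere (0 : V2) 1 => f.I xv.1 (xv.2 : V2) N) := by
    by_contra hcon
    unfold unifInf at hpos
    rw [iInf, Real.sInf_of_not_bddBelow hcon] at hpos
    exact lt_irrefl _ hpos
  exact ciInf_le hb (x, ⟨v, mem_sphere_zero_iff_norm.2 hv⟩)

lemma ls_fibre_exp (hr : 2 ≤ r) (hdeg : 2 ≤ f.deg) (hC : 0 < f.C) :
    ∃ N : ℕ, 1 ≤ N ∧ ∃ c : ℝ, 0 < c ∧ ∃ t0 : ℝ, 0 < t0 ∧ ∀ t : ℝ, 0 < t → t ≤ t0 →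
      0 ≤ 1 - t * c ∧
      ∀ (x : T2) (v : V2), v ≠ 0 → ∀ s : Finset T2, (∀ y ∈ s, f.toFun^[N] y = x) →
        ∑ y ∈ s, ‖f.Dninv N y v‖ ^ (-t) ≤ (f.deg : ℝ) ^ N * (1 - t * c) * ‖v‖ ^ (-t) := by
  obtain ⟨N, hN, c, hc, hI⟩ := f.ls_C_pos hC
  obtain ⟨B, hB1, hB⟩ := f.ls_log_bdd hr N
  have hA : f.A.det ≠ 0 := by
    intro h0; unfold deg at hdeg; rw [h0] at hdeg; simp at hdeg
  refine ⟨N, hN, c / 2, by positivity, min (min (1 / B) (c / (2 * B ^ 2))) (1 / c), by positivity,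
    fun t ht htt => ?_⟩
  have ht1 : t * B ≤ 1 := by
    have := htt.trans ((min_le_left _ _).trans (min_le_left _ _))
    rwa [le_div_iff₀ (by positivity)] at this
  have ht2 : t * B ^ 2 ≤ c / 2 := by
    have := htt.trans ((min_le_left _ _).trans (min_le_right _ _))
    rw [le_div_iff₀ (by positivity)] at this
    linarith
  have ht3 : t * c ≤ 1 := by
    have := htt.trans (min_le_right _ _)
    rwa [le_div_iff₀ (by positivity)] at this
  refine ⟨by linarith, ?_⟩
  -- unit vectors first
  have key : ∀ (x : T2) (v : V2), ‖v‖ = 1 → ∀ s : Finset T2, (∀ y ∈ s, f.toFun^[N] y = x) →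
        ∑ y ∈ s, ‖f.Dninv N y v‖ ^ (-t) ≤ (f.deg : ℝ) ^ N * (1 - t * (c / 2)) := by
    intro x v hv s hs
    obtain ⟨hfin, hcard⟩ := f.ls_fiber_iter hr hA N x
    have hd : (0:ℝ) < (f.deg : ℝ) ^ N := by
      have : 0 < f.deg := by omega
      positivity
    have hsub : s ⊆ hfin.toFinset := by
      intro y hy
      simpa using hs y hy
    have hvne : v ≠ 0 := by intro h0; rw [h0] at hv; simp at hv
    have hcard' : (hfin.toFinset.card : ℝ) ≤ (f.deg : ℝ) ^ N := by
      rw [Set.ncard_eq_toFinset_card _ hfin] at hcard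
      exact_mod_cast hcard
    have hIx := hI x v hv
    unfold I at hIx
    rw [finsum_mem_eq_finite_toFinset_sum _ hfin, le_inv_mul_iff₀ hd] at hIx
    calc ∑ y ∈ s, ‖f.Dninv N y v‖ ^ (-t) ≤ ∑ y ∈ hfin.toFinset, ‖f.Dninv N y v‖ ^ (-t) :=
          Finset.sum_le_sum_of_subset_of_nonneg hsub (fun _ _ _ => by positivity)
      _ ≤ ∑ y ∈ hfin.toFinset, (1 - t * Real.log ‖f.Dninv N y v‖ + t ^ 2 * B ^ 2) := by
          apply Finset.sum_le_sum
          intro y _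
          have hpos : 0 < ‖f.Dninv N y v‖ := norm_pos_iff.2 (f.ls_Dninv_ne N y _ hvne)
          rw [Real.rpow_def_of_pos hpos]
          set u := Real.log ‖f.Dninv N y v‖ with hu
          have hub : |u| ≤ B := hB y v hv
          have h1 : |u * -t| ≤ 1 := by
            rw [abs_mul, abs_neg, abs_of_pos ht]
            nlinarith
          have h2 := (abs_le.1 (Real.abs_exp_sub_one_sub_id_le h1)).2
          have h3 : u ^ 2 ≤ B ^ 2 := sq_le_sq' (by linarith [(abs_le.1 hub).1]) (abs_le.1 hub).2
          nlinarith [mul_le_mul_of_nonneg_left h3 (sq_nonneg t)]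
      _ = hfin.toFinset.card * (1 + t ^ 2 * B ^ 2) - t * ∑ y ∈ hfin.toFinset,
            Real.log ‖f.Dninv N y v‖ := by
          rw [Finset.mul_sum, Finset.sum_add_distrib, Finset.sum_sub_distrib]
          simp only [Finset.sum_const, nsmul_eq_mul]
          ring
      _ ≤ (f.deg : ℝ) ^ N * (1 + t ^ 2 * B ^ 2) - t * ((f.deg : ℝ) ^ N * c) := by
          apply sub_le_sub
          · exact mul_le_mul_of_nonneg_right hcard' (by positivity)
          · exact mul_le_mul_of_nonneg_left hIx ht.le
      _ ≤ (f.deg : ℝ) ^ N * (1 - t * (c / 2)) := by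
          have := mul_le_mul_of_nonneg_left ht2 (mul_pos ht hd).le
          nlinarith
  intro x v hv s hs
  have hvp : 0 < ‖v‖ := norm_pos_iff.2 hv
  have h1 : ∀ y, ‖f.Dninv N y v‖ ^ (-t) = ‖f.Dninv N y (‖v‖⁻¹ • v)‖ ^ (-t) * ‖v‖ ^ (-t) := by
    intro y
    rw [← Real.mul_rpow (norm_nonneg _) hvp.le]
    congr 1
    rw [map_smul, norm_smul, norm_inv, norm_norm]
    field_simp
  simp_rw [h1]
  rw [← Finset.sum_mul]
  apply mul_le_mul_of_nonneg_right _ (by positivity)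
  apply key x _ _ s hs
  rw [norm_smul, norm_inv, norm_norm]
  field_simp

end TorusMap

/-! ### The transfer inequality -/

namespace TorusMap

variable {r : ℕ} (f g : TorusMap r)

lemma ls_F_lip {M : ℝ} (hr : 2 ≤ r) (hg : LsNice M g) (p q : V2) :
    ‖g.F q - g.F p‖ ≤ M * ‖q - p‖ := by
  refine Convex.norm_image_sub_le_of_norm_hasFDerivWithin_le (s := univ)
      (f := g.F) (f' := fun q => fderiv ℝ g.F q)
      ?_ ?_ convex_univ (mem_univ _) (mem_univ _)
  · intro z _
    exact (g.ls_diff hr z).hasFDerivAt.hasFDerivWithinAt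
  · intro z _
    rw [← g.D_proj]
    exact ContinuousLinearMap.opNorm_le_bound _ (by linarith [hg.one_le]) (hg.upper _)

lemma ls_S_lip {M : ℝ} (hr : 2 ≤ r) (hg : LsNice M g) {S : V2 → V2} (hS : ContDiff ℝ r S)
    (hFS : ∀ p, g.F (S p) = p) (p q : V2) :
    ‖S q - S p‖ ≤ M * ‖q - p‖ := by
  have hd : Differentiable ℝ S := hS.differentiable (by norm_cast; omega)
  refine Convex.norm_image_sub_le_of_norm_hasFDerivWithin_le (s := univ)
      (f := S) (f' := fun q => fderiv ℝ S q)
      ?_ ?_ convex_univ (mem_univ _) (mem_univ _)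
  · intro z _
    exact (hd z).hasFDerivAt.hasFDerivWithinAt
  · intro z _
    refine ContinuousLinearMap.opNorm_le_bound _ (by linarith [hg.one_le]) (fun v => ?_)
    refine (hg.lower (proj (S z)) _).trans ?_
    have h1 : HasFDerivAt (fun p => g.F (S p)) ((fderiv ℝ g.F (S z)).comp (fderiv ℝ S z)) z :=
      (g.ls_diff hr (S z)).hasFDerivAt.comp z (hd z).hasFDerivAt
    have h2 : (fun p => g.F (S p)) = id := by ext1 p; exact hFS p
    rw [h2] at h1
    have h3 := h1.unique (hasFDerivAt_id z)
    rw [g.D_proj, ← ContinuousLinearMap.comp_apply, h3]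
    simp

lemma ls_lip {M : ℝ} (hr : 2 ≤ r) (hg : LsNice M g) (x y : T2) :
    dist (g.toFun x) (g.toFun y) ≤ (2 * M) * dist x y := by
  obtain ⟨p, rfl⟩ := ls_proj_surj x
  obtain ⟨q, rfl, hq⟩ := ls_lift_near p y
  rw [g.toFun_proj, g.toFun_proj, dist_comm]
  refine (ls_proj_dist _ _).trans ((g.ls_F_lip hr hg p q).trans ?_)
  have := mul_le_mul_of_nonneg_left hq (zero_le_one.trans hg.one_le)
  linarith

lemma ls_inj_one {M : ℝ} (hr : 2 ≤ r) (hA : g.A.det ≠ 0) (hg : LsNice M g) {x y : T2}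
    (hxy : dist x y ≤ 1 / (4 * M)) (h : g.toFun x = g.toFun y) : x = y := by
  obtain ⟨S, -, hS, -⟩ := g.ls_exists_inv hr hA
  obtain ⟨p, rfl⟩ := ls_proj_surj x
  obtain ⟨q, rfl, hq⟩ := ls_lift_near p y
  rw [g.toFun_proj, g.toFun_proj] at h
  obtain ⟨m, hm⟩ := ls_proj_eq h
  have h1 := g.ls_F_lip hr hg p q
  have hM := hg.one_le
  have h2 : ‖iv m‖ ≤ 1 / 2 := by
    rw [hm, add_sub_cancel_left] at h1
    refine h1.trans ?_
    rw [le_div_iff₀ (by positivity)] at hxy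
    have := mul_le_mul_of_nonneg_left hq (zero_le_one.trans hM)
    linarith
  have h3 : iv m = 0 := by
    ext i
    have h4 := (ls_coord_le (iv m) i).trans h2
    rw [ls_iv_apply] at h4 ⊢
    have h5 : |m i| < 1 := by
      have : |(m i : ℝ)| < 1 := by linarith
      exact_mod_cast this
    rw [Int.abs_lt_one_iff] at h5
    simp [h5]
  rw [h3, add_zero] at hm
  rw [← hS p, ← hS q, hm]

lemma ls_inj_iter {M : ℝ} (hr : 2 ≤ r) (hA : g.A.det ≠ 0) (hg : LsNice M g) (n : ℕ) : ∀ x y : T2,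
    dist x y ≤ 1 / (4 * M) / (2 * M) ^ n → g.toFun^[n] x = g.toFun^[n] y → x = y := by
  have hM := hg.one_le
  induction n with
  | zero => intro x y _ h; exact h
  | succ n ih =>
    intro x y hxy h
    rw [le_div_iff₀ (by positivity)] at hxy
    have hp : 1 ≤ (2 * M) ^ (n + 1) := one_le_pow₀ (by linarith)
    apply g.ls_inj_one hr hA hg (le_trans _ hxy)
    · apply ih
      · rw [le_div_iff₀ (by positivity)]
        refine le_trans ?_ hxy
        rw [pow_succ]
        have := mul_le_mul_of_nonneg_right (g.ls_lip hr hg x y) (by positivity : 0 ≤ (2 * M) ^ n)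
        linarith
      · simpa only [Function.iterate_succ_apply] using h
    · nlinarith [dist_nonneg (x := x) (y := y)]

lemma ls_open_one {M : ℝ} (hr : 2 ≤ r) (hA : g.A.det ≠ 0) (hg : LsNice M g) (y x : T2) :
    ∃ z, g.toFun z = x ∧ dist y z ≤ (2 * M) * dist (g.toFun y) x := by
  obtain ⟨S, hSc, hS, hS2⟩ := g.ls_exists_inv hr hA
  obtain ⟨p, rfl⟩ := ls_proj_surj y
  rw [g.toFun_proj]
  obtain ⟨q, rfl, hq⟩ := ls_lift_near (g.F p) x
  refine ⟨proj (S q), by rw [g.toFun_proj, hS2], ?_⟩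
  rw [dist_comm]
  refine (ls_proj_dist _ _).trans ?_
  have h1 := g.ls_S_lip hr hg hSc hS2 (g.F p) q
  rw [hS] at h1
  have := mul_le_mul_of_nonneg_left hq (zero_le_one.trans hg.one_le)
  linarith

lemma ls_open_iter {M : ℝ} (hr : 2 ≤ r) (hA : g.A.det ≠ 0) (hg : LsNice M g) (n : ℕ) :
    ∀ y x : T2, ∃ z, g.toFun^[n] z = x ∧ dist y z ≤ (2 * M) ^ n * dist (g.toFun^[n] y) x := by
  have hM := hg.one_le
  induction n with
  | zero => intro y x; exact ⟨x, rfl, by simp⟩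
  | succ n ih =>
    intro y x
    obtain ⟨w, hw, hwd⟩ := ih (g.toFun y) x
    obtain ⟨z, hz, hzd⟩ := g.ls_open_one hr hA hg y w
    refine ⟨z, by rw [Function.iterate_succ_apply, hz, hw], hzd.trans ?_⟩
    rw [Function.iterate_succ_apply, pow_succ]
    have := mul_le_mul_of_nonneg_left hwd (by positivity : 0 ≤ 2 * M)
    linarith

lemma ls_close (hr : 2 ≤ r) (n : ℕ) : ∀ ε : ℝ, 0 < ε → ∃ η : ℝ, 0 < η ∧ ∀ g : TorusMap r,
    distC 2 f g < η → ∀ x, dist (f.toFun^[n] x) (g.toFun^[n] x) ≤ ε ∧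
      ‖f.Dn n x - g.Dn n x‖ ≤ ε := by
  induction n with
  | zero =>
    intro ε hε
    refine ⟨1, one_pos, fun g _ x => ?_⟩
    simp only [Function.iterate_zero, id, dist_self, Dn, sub_self, norm_zero]
    exact ⟨hε.le, hε.le⟩
  | succ n ih =>
    intro ε hε
    obtain ⟨B1, hB1⟩ := (isCompact_univ (X := T2)).exists_bound_of_continuousOn
      (f.ls_cont_D hr).continuousOn
    obtain ⟨B2, hB2⟩ := (isCompact_univ (X := T2)).exists_bound_of_continuousOn
      (f.ls_cont_Dn hr n).continuousOn
    have hB1' : 0 ≤ B1 := (norm_nonneg _).trans (hB1 0 (mem_univ _))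
    have hB2' : 0 ≤ B2 := (norm_nonneg _).trans (hB2 0 (mem_univ _))
    set B := B1 + B2 + 2 with hB
    have hBp : 0 < B := by linarith
    set ε' := min 1 (ε / (3 * B)) with hε'
    have hε'p : 0 < ε' := by positivity
    have hε'1 : ε' ≤ 1 := min_le_left _ _
    have hε'2 : ε' * (3 * B) ≤ ε := by
      rw [← le_div_iff₀ (by positivity)]; exact min_le_right _ _
    obtain ⟨η1, hη1, h1⟩ := ih ε' hε'p
    have uc1 := CompactSpace.uniformContinuous_of_continuous (f.ls_cont_iter n)
    have uc2 := CompactSpace.uniformContinuous_of_continuous (f.ls_cont_Dn hr n)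
    obtain ⟨δ1, hδ1, hu1⟩ := Metric.uniformContinuous_iff.1 uc1 ε' hε'p
    obtain ⟨δ2, hδ2, hu2⟩ := Metric.uniformContinuous_iff.1 uc2 ε' hε'p
    refine ⟨min (min η1 ε') (min (δ1 / 2) (δ2 / 2)), by positivity, fun g hg x => ?_⟩
    have hgη := lt_of_lt_of_le hg ((min_le_left _ _).trans (min_le_left _ _))
    have hgε := lt_of_lt_of_le hg ((min_le_left _ _).trans (min_le_right _ _))
    have hgδ1 := lt_of_lt_of_le hg ((min_le_right _ _).trans (min_le_left _ _))
    have hgδ2 := lt_of_lt_of_le hg ((min_le_right _ _).trans (min_le_right _ _))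
    have e1 := (f.ls_distC g hr hgδ1).1 x
    have e2 := (f.ls_distC g hr hgδ2).1 x
    have e3 := (f.ls_distC g hr hgε).2.1 x
    have k1 := hu1 (a := f.toFun x) (b := g.toFun x) (by linarith)
    have k2 := hu2 (a := f.toFun x) (b := g.toFun x) (by linarith)
    obtain ⟨i1, i2⟩ := h1 g hgη (g.toFun x)
    constructor
    · rw [Function.iterate_succ_apply, Function.iterate_succ_apply]
      refine (dist_triangle _ (f.toFun^[n] (g.toFun x)) _).trans ?_
      nlinarith
    · have hdec : f.Dn (n + 1) x - g.Dn (n + 1) x =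
        (f.Dn n (f.toFun x)).comp (f.D x - g.D x) +
        ((f.Dn n (f.toFun x) - f.Dn n (g.toFun x)) +
          (f.Dn n (g.toFun x) - g.Dn n (g.toFun x))).comp (g.D x) := by
        ext1 v
        simp [Dn]
      rw [hdec]
      have hgD : ‖g.D x‖ ≤ B1 + 1 := by
        have := norm_sub_norm_le (g.D x) (f.D x)
        rw [norm_sub_rev] at this
        linarith [hB1 x (mem_univ _)]
      rw [dist_eq_norm] at k2
      calc _ ≤ ‖f.Dn n (f.toFun x)‖ * ‖f.D x - g.D x‖ +
          ‖(f.Dn n (f.toFun x) - f.Dn n (g.toFun x)) +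
          (f.Dn n (g.toFun x) - g.Dn n (g.toFun x))‖ * ‖g.D x‖ :=
            (norm_add_le _ _).trans (add_le_add (ContinuousLinearMap.opNorm_comp_le _ _)
              (ContinuousLinearMap.opNorm_comp_le _ _))
        _ ≤ B2 * ε' + (ε' + ε') * (B1 + 1) := by
            have := norm_add_le (f.Dn n (f.toFun x) - f.Dn n (g.toFun x))
              (f.Dn n (g.toFun x) - g.Dn n (g.toFun x))
            gcongr
            · exact hB2 _ (mem_univ _)
            · linarith
        _ ≤ ε := by nlinarith

lemma ls_inv_compare {B ε : ℝ} {n : ℕ} {y z : T2} (hB : ‖f.Dninv n z‖ ≤ B)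
    (h : B * ‖f.Dn n z - g.Dn n y‖ ≤ ε) (v : V2) :
    ‖f.Dninv n z v‖ ≤ (1 + ε) * ‖g.Dninv n y v‖ := by
  have h1 : f.Dninv n z v - g.Dninv n y v =
      f.Dninv n z ((g.Dn n y - f.Dn n z) (g.Dninv n y v)) := by
    rw [sub_apply, g.ls_Dn_inv_right, map_sub, f.ls_Dn_inv_left]
  have h2 : ‖f.Dninv n z v - g.Dninv n y v‖ ≤ ε * ‖g.Dninv n y v‖ := by
    rw [h1]
    have hB0 : 0 ≤ B := (norm_nonneg _).trans hB
    calc _ ≤ B * (‖g.Dn n y - f.Dn n z‖ * ‖g.Dninv n y v‖) := by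
          refine (ContinuousLinearMap.le_opNorm _ _).trans ?_
          exact mul_le_mul hB (ContinuousLinearMap.le_opNorm _ _) (norm_nonneg _) hB0
      _ ≤ _ := by
          rw [norm_sub_rev, ← mul_assoc]
          exact mul_le_mul_of_nonneg_right h (norm_nonneg _)
  have := norm_sub_norm_le (f.Dninv n z v) (g.Dninv n y v)
  linarith

end TorusMap

/-! ### Integration over fibres -/

lemma ls_sum_lintegral_le {α ι : Type*} [MeasurableSpace α] (μ : Measure α) (s : Finset ι)
    (φ : ι → α → ℝ≥0∞) : ∑ i ∈ s, ∫⁻ x, φ i x ∂μ ≤ ∫⁻ x, ∑ i ∈ s, φ i x ∂μ := by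
  classical
  induction s using Finset.induction_on with
  | empty => simp
  | insert a s ha ih =>
    simp_rw [Finset.sum_insert ha]
    exact (add_le_add le_rfl ih).trans (le_lintegral_add _ _)

namespace TorusMap

variable {r : ℕ} (f g : TorusMap r)

lemma ls_equi_iter {μ : Measure T2} (h : g.Equidistributed μ) (n : ℕ) : ∀ s : Set T2,
    MeasurableSet s → InjOn (g.toFun^[n]) s →
    μ (g.toFun^[n] '' s) = (g.deg : ℝ≥0∞) ^ n * μ s := by
  induction n with
  | zero => intro s _ _; simp
  | succ n ih =>
    intro s hs hinj
    rw [Function.iterate_succ] at hinj ⊢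
    have h1 : InjOn g.toFun s := hinj.of_comp
    have h2 : InjOn (g.toFun^[n]) (g.toFun '' s) := hinj.image_of_comp
    have h3 : MeasurableSet (g.toFun '' s) :=
      hs.image_of_continuousOn_injOn g.ls_cont.continuousOn h1
    rw [image_comp, ih _ h3 h2, h s hs h1, pow_succ, mul_assoc]

lemma ls_piece {μ : Measure T2} [IsFiniteMeasure μ] (hd : g.deg ≠ 0) (h : g.Equidistributed μ)
    (n : ℕ) {s : Set T2} (hs : MeasurableSet s) (hinj : InjOn (g.toFun^[n]) s)
    (φ : T2 → ℝ≥0∞) (σ : T2 → T2) (hσ : ∀ y ∈ s, σ (g.toFun^[n] y) = y) :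
    (g.deg : ℝ≥0∞) ^ n * ∫⁻ y in s, φ y ∂μ =
      ∫⁻ x, (g.toFun^[n] '' s).indicator (fun x => φ (σ x)) x ∂μ := by
  have hdn : (g.deg : ℝ≥0∞) ^ n ≠ 0 := pow_ne_zero _ (by exact_mod_cast hd)
  have hdt : (g.deg : ℝ≥0∞) ^ n ≠ ∞ := ENNReal.pow_ne_top (ENNReal.natCast_ne_top _)
  have himg : MeasurableSet (g.toFun^[n] '' s) :=
    hs.image_of_continuousOn_injOn (g.ls_cont_iter n).continuousOn hinj
  let j : s → T2 := s.restrict (g.toFun^[n])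
  have hjm : Measurable j := (g.ls_cont_iter n).measurable.comp measurable_subtype_coe
  have : StandardBorelSpace s := hs.standardBorel
  have hj : MeasurableEmbedding j := hjm.measurableEmbedding (injOn_iff_injective.1 hinj)
  have hmap : (g.deg : ℝ≥0∞) ^ n • (μ.comap ((↑) : s → T2)).map j =
      μ.restrict (g.toFun^[n] '' s) := by
    ext t ht
    rw [Measure.smul_apply, Measure.map_apply hjm ht, Measure.restrict_apply ht,
      (MeasurableEmbedding.subtype_coe hs).comap_apply, smul_eq_mul]
    have h1 : ((↑) : s → T2) '' (j ⁻¹' t) = s ∩ g.toFun^[n] ⁻¹' t := by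
      ext y
      simp only [mem_image, mem_preimage, Subtype.exists, exists_and_right, exists_eq_right,
        mem_inter_iff]
      constructor
      · rintro ⟨hy, h2⟩; exact ⟨hy, h2⟩
      · rintro ⟨hy, h2⟩; exact ⟨hy, h2⟩
    rw [h1, ← g.ls_equi_iter h n _ (hs.inter ((g.ls_cont_iter n).measurable ht))
      (hinj.mono inter_subset_left)]
    congr 1
    rw [image_inter_preimage, inter_comm]
  rw [lintegral_indicator himg, ← hmap, lintegral_smul_measure, hj.lintegral_map,
    ← lintegral_subtype_comap hs, smul_eq_mul]
  congr 1
  apply lintegral_congr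
  intro a
  have : σ (j a) = a := hσ a a.2
  rw [this]

lemma ls_transfer {M : ℝ} (hr : 2 ≤ r) (hA : g.A.det ≠ 0) (hg : LsNice M g)
    {μ : Measure T2} [IsFiniteMeasure μ] (h : g.Equidistributed μ) (n : ℕ)
    (φ ψ : T2 → ℝ≥0∞)
    (hφ : ∀ x, ∀ s : Finset T2, (∀ y ∈ s, g.toFun^[n] y = x) →
      ∑ y ∈ s, φ y ≤ (g.deg : ℝ≥0∞) ^ n * ψ x) :
    ∫⁻ y, φ y ∂μ ≤ ∫⁻ x, ψ x ∂μ := by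
  classical
  have hM := hg.one_le
  have hd : g.deg ≠ 0 := by
    unfold deg; simpa using hA
  have hdn : (g.deg : ℝ≥0∞) ^ n ≠ 0 := pow_ne_zero _ (by exact_mod_cast hd)
  have hdt : (g.deg : ℝ≥0∞) ^ n ≠ ∞ := ENNReal.pow_ne_top (ENNReal.natCast_ne_top _)
  set δ := 1 / (4 * M) / (2 * M) ^ n with hδ
  have hδp : 0 < δ := by positivity
  let u := TopologicalSpace.denseSeq T2
  let A : ℕ → Set T2 := disjointed fun k => Metric.ball (u k) (δ / 2)
  have hAm : ∀ k, MeasurableSet (A k) :=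
    fun k => MeasurableSet.disjointed (fun k => Metric.isOpen_ball.measurableSet) k
  have hAd : Pairwise (Function.onFun Disjoint A) := disjoint_disjointed _
  have hAu : ⋃ k, A k = univ := by
    rw [iUnion_disjointed, eq_univ_iff_forall]
    intro x
    obtain ⟨k, hk⟩ := (TopologicalSpace.denseRange_denseSeq T2).exists_dist_lt x (half_pos hδp)
    exact mem_iUnion.2 ⟨k, hk⟩
  have hAi : ∀ k, InjOn (g.toFun^[n]) (A k) := by
    intro k x hx y hy hxy
    have h1 : dist x (u k) < δ / 2 := disjointed_subset _ k hx
    have h2 : dist y (u k) < δ / 2 := disjointed_subset _ k hy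
    refine g.ls_inj_iter hr hA hg n x y ?_ hxy
    have := dist_triangle_right x y (u k)
    linarith
  let σ : ℕ → T2 → T2 := fun k => Function.invFunOn (g.toFun^[n]) (A k)
  have hσ : ∀ k, ∀ y ∈ A k, σ k (g.toFun^[n] y) = y := fun k y hy =>
    (hAi k).leftInvOn_invFunOn hy
  have hkey : (g.deg : ℝ≥0∞) ^ n * ∫⁻ y, φ y ∂μ ≤ (g.deg : ℝ≥0∞) ^ n * ∫⁻ x, ψ x ∂μ := by
    rw [← setLIntegral_univ, ← hAu, lintegral_iUnion hAm hAd, ← ENNReal.tsum_mul_left]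
    rw [ENNReal.tsum_eq_iSup_sum]
    apply iSup_le
    intro s
    simp_rw [fun k => g.ls_piece hd h n (hAm k) (hAi k) φ (σ k) (hσ k)]
    refine (ls_sum_lintegral_le _ _ _).trans ?_
    rw [← lintegral_const_mul' _ _ hdt]
    apply lintegral_mono
    intro x
    have h1 : ∑ k ∈ s, (g.toFun^[n] '' A k).indicator (fun x => φ (σ k x)) x =
        ∑ k ∈ s.filter (fun k => x ∈ g.toFun^[n] '' A k), φ (σ k x) := by
      rw [Finset.sum_filter]
      apply Finset.sum_congr rfl
      intro k _
      rw [indicator_apply]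
    have hmem : ∀ k ∈ s.filter (fun k => x ∈ g.toFun^[n] '' A k),
        σ k x ∈ A k ∧ g.toFun^[n] (σ k x) = x := by
      intro k hk
      obtain ⟨y, hy, rfl⟩ := (Finset.mem_filter.1 hk).2
      rw [hσ k y hy]
      exact ⟨hy, rfl⟩
    have hinj : Set.InjOn (fun k => σ k x) (s.filter (fun k => x ∈ g.toFun^[n] '' A k)) := by
      intro k hk l hl hkl
      by_contra hne
      have h2 := (hmem k hk).1
      have h3 := (hmem l hl).1
      simp only at hkl
      rw [hkl] at h2
      exact Set.disjoint_left.1 (hAd hne) h2 h3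
    show ∑ k ∈ s, (g.toFun^[n] '' A k).indicator (fun x => φ (σ k x)) x ≤ _
    rw [h1, ← Finset.sum_image (f := φ) hinj]
    apply hφ
    intro y hy
    obtain ⟨k, hk, rfl⟩ := Finset.mem_image.1 hy
    exact (hmem k hk).2
  exact (ENNReal.mul_le_mul_iff_right hdn hdt).1 hkey

end TorusMap

/-! ### Contraction of the fibre averages for nearby maps -/

namespace TorusMap

variable {r : ℕ} (f g : TorusMap r)

lemma ls_onestep (hr : 2 ≤ r) (hA : f.A.det ≠ 0) {N : ℕ} {c t : ℝ} (hc : 0 < c) (ht : 0 < t)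
    (htc : 0 ≤ 1 - t * c) {M η0 : ℝ} (hη0 : 0 < η0)
    (hnice : ∀ g : TorusMap r, distC 2 f g < η0 → LsNice M g ∧ g.A = f.A)
    (hf : LsNice M f)
    (hexp : ∀ (x : T2) (v : V2), v ≠ 0 → ∀ s : Finset T2, (∀ y ∈ s, f.toFun^[N] y = x) →
        ∑ y ∈ s, ‖f.Dninv N y v‖ ^ (-t) ≤ (f.deg : ℝ) ^ N * (1 - t * c) * ‖v‖ ^ (-t)) :
    ∃ ρ : ℝ, 0 < ρ ∧ ρ < 1 ∧ ∃ η : ℝ, 0 < η ∧ ∀ g : TorusMap r, distC 2 f g < η →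
      ∀ μ : Measure T2, IsProbabilityMeasure μ → g.Equidistributed μ →
      ∀ (h : T2 → ℝ≥0∞) (v : T2 → V2), (∀ x, v x ≠ 0) →
        ∫⁻ y, h (g.toFun^[N] y) * ENNReal.ofReal (‖g.Dninv N y (v (g.toFun^[N] y))‖ ^ (-t)) ∂μ ≤
        ENNReal.ofReal ρ * ∫⁻ x, h x * ENNReal.ofReal (‖v x‖ ^ (-t)) ∂μ := by
  classical
  have hM := hf.one_le
  have htcp : 0 < t * c := by positivity
  -- choice of `ε`
  obtain ⟨ε, hε, hεt⟩ : ∃ ε : ℝ, 0 < ε ∧ (1 + ε) ^ t * (1 - t * c) ≤ 1 - t * c / 2 := by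
    have hcont : Tendsto (fun ε : ℝ => (1 + ε) ^ t * (1 - t * c)) (𝓝[>] 0) (𝓝 ((1 + 0) ^ t * (1 - t * c))) := by
      apply Tendsto.mono_left _ nhdsWithin_le_nhds
      apply Tendsto.mul_const
      exact (tendsto_const_nhds.add tendsto_id).rpow_const (Or.inr ht.le)
    have hlt : ((1 + 0) ^ t * (1 - t * c) : ℝ) < 1 - t * c / 2 := by
      rw [add_zero, Real.one_rpow]; linarith
    have h1 := hcont.eventually (gt_mem_nhds hlt)
    obtain ⟨ε, h2, h3⟩ := (h1.and self_mem_nhdsWithin).exists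
    exact ⟨ε, h3, h2.le⟩
  obtain ⟨B0, hB0⟩ := (isCompact_univ (X := T2)).exists_bound_of_continuousOn
    (f.ls_cont_Dninv hr N).continuousOn
  set B := max B0 1 with hB
  have hB1 : 1 ≤ B := le_max_right _ _
  have hBb : ∀ z, ‖f.Dninv N z‖ ≤ B := fun z => (hB0 z (mem_univ _)).trans (le_max_left _ _)
  have uc := CompactSpace.uniformContinuous_of_continuous (f.ls_cont_Dn hr N)
  obtain ⟨δ1, hδ1, hu1⟩ := Metric.uniformContinuous_iff.1 uc (ε / (2 * B)) (by positivity)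
  set δ := 1 / (4 * M) / (2 * M) ^ N with hδ
  have hδp : 0 < δ := by positivity
  have hMN : (0:ℝ) < (2 * M) ^ N := by positivity
  set ε1 := min (min (ε / (2 * B)) (δ1 / 2 / (2 * M) ^ N)) (δ / 2 / (2 * M) ^ N) with hε1
  have hε1p : 0 < ε1 := by positivity
  have hε1a : ε1 ≤ ε / (2 * B) := (min_le_left _ _).trans (min_le_left _ _)
  have hε1b : (2 * M) ^ N * ε1 ≤ δ1 / 2 := by
    have : ε1 ≤ δ1 / 2 / (2 * M) ^ N := (min_le_left _ _).trans (min_le_right _ _)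
    rw [le_div_iff₀ hMN] at this
    linarith
  have hε1c : (2 * M) ^ N * ε1 ≤ δ / 2 := by
    have : ε1 ≤ δ / 2 / (2 * M) ^ N := min_le_right _ _
    rw [le_div_iff₀ hMN] at this
    linarith
  obtain ⟨η1, hη1, hclose⟩ := f.ls_close hr N ε1 hε1p
  refine ⟨1 - t * c / 2, by linarith, by linarith, min η0 η1, by positivity, ?_⟩
  intro g hg μ hμ hequi h v hv
  obtain ⟨hgn, hgA⟩ := hnice g (lt_of_lt_of_le hg (min_le_left _ _))
  have hcl := hclose g (lt_of_lt_of_le hg (min_le_right _ _))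
  have hgA' : g.A.det ≠ 0 := by rw [hgA]; exact hA
  have hgd : g.deg = f.deg := by unfold deg; rw [hgA]
  rw [← lintegral_const_mul' _ _ ENNReal.ofReal_ne_top]
  apply g.ls_transfer hr hgA' hgn hequi N
  intro x s hs
  choose! z hz1 hz2 using fun y : T2 => f.ls_open_iter hr hA hf N y x
  have hzd : ∀ y ∈ s, dist y (z y) ≤ (2 * M) ^ N * ε1 := by
    intro y hy
    refine (hz2 y).trans (mul_le_mul_of_nonneg_left ?_ hMN.le)
    rw [← hs y hy]
    exact (hcl y).1
  have hzinj : Set.InjOn z s := by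
    intro y1 h1 y2 h2 h12
    apply g.ls_inj_iter hr hgA' hgn N
    · have a1 := hzd y1 h1
      have a2 := hzd y2 h2
      rw [h12] at a1
      have := dist_triangle_right y1 y2 (z y2)
      show _ ≤ δ
      linarith
    · rw [hs y1 h1, hs y2 h2]
  have hreal : ∑ y ∈ s, ‖g.Dninv N y (v x)‖ ^ (-t) ≤
      (f.deg : ℝ) ^ N * (1 - t * c / 2) * ‖v x‖ ^ (-t) := by
    calc ∑ y ∈ s, ‖g.Dninv N y (v x)‖ ^ (-t)
        ≤ ∑ y ∈ s, (1 + ε) ^ t * ‖f.Dninv N (z y) (v x)‖ ^ (-t) := by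
          apply Finset.sum_le_sum
          intro y hy
          have hcomp : ‖f.Dninv N (z y) (v x)‖ ≤ (1 + ε) * ‖g.Dninv N y (v x)‖ := by
            apply f.ls_inv_compare g (hBb _)
            have k1 := hu1 (a := z y) (b := y) (by
              rw [dist_comm]; linarith [hzd y hy])
            rw [dist_eq_norm] at k1
            have k2 := (hcl y).2
            have k3 : ‖f.Dn N (z y) - g.Dn N y‖ ≤ ε / B := by
              have := norm_sub_le_norm_sub_add_norm_sub (f.Dn N (z y)) (f.Dn N y) (g.Dn N y)
              have e : ε / (2 * B) + ε / (2 * B) = ε / B := by field_simp; norm_num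
              linarith
            rw [le_div_iff₀ (by positivity)] at k3
            linarith
          have p1 : 0 < ‖f.Dninv N (z y) (v x)‖ := norm_pos_iff.2 (f.ls_Dninv_ne _ _ _ (hv x))
          have p2 : 0 < ‖g.Dninv N y (v x)‖ := norm_pos_iff.2 (g.ls_Dninv_ne _ _ _ (hv x))
          have p3 := Real.rpow_le_rpow p1.le hcomp ht.le
          rw [Real.mul_rpow (by positivity) p2.le] at p3
          rw [Real.rpow_neg p1.le, Real.rpow_neg p2.le, ← div_eq_mul_inv, inv_eq_one_div,
            div_le_div_iff₀ (by positivity) (by positivity), one_mul]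
          exact p3
      _ = (1 + ε) ^ t * ∑ w ∈ s.image z, ‖f.Dninv N w (v x)‖ ^ (-t) := by
          rw [← Finset.mul_sum, Finset.sum_image hzinj]
      _ ≤ (1 + ε) ^ t * ((f.deg : ℝ) ^ N * (1 - t * c) * ‖v x‖ ^ (-t)) := by
          apply mul_le_mul_of_nonneg_left _ (by positivity)
          apply hexp x _ (hv x)
          intro w hw
          obtain ⟨y, -, rfl⟩ := Finset.mem_image.1 hw
          exact hz1 y
      _ = (f.deg : ℝ) ^ N * ((1 + ε) ^ t * (1 - t * c)) * ‖v x‖ ^ (-t) := by ring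
      _ ≤ _ := by gcongr
  calc ∑ y ∈ s, h (g.toFun^[N] y) * ENNReal.ofReal (‖g.Dninv N y (v (g.toFun^[N] y))‖ ^ (-t))
      = ∑ y ∈ s, h x * ENNReal.ofReal (‖g.Dninv N y (v x)‖ ^ (-t)) := by
        apply Finset.sum_congr rfl
        intro y hy
        rw [hs y hy]
    _ = h x * ENNReal.ofReal (∑ y ∈ s, ‖g.Dninv N y (v x)‖ ^ (-t)) := by
        rw [← Finset.mul_sum, ENNReal.ofReal_sum_of_nonneg (fun _ _ => by positivity)]
    _ ≤ h x * ENNReal.ofReal ((f.deg : ℝ) ^ N * (1 - t * c / 2) * ‖v x‖ ^ (-t)) := by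
        gcongr
    _ = (g.deg : ℝ≥0∞) ^ N * (ENNReal.ofReal (1 - t * c / 2) *
          (h x * ENNReal.ofReal (‖v x‖ ^ (-t)))) := by
        rw [ENNReal.ofReal_mul (by have : 0 ≤ 1 - t * c / 2 := by linarith
                                   positivity),
          ENNReal.ofReal_mul (by positivity), ENNReal.ofReal_pow (by positivity),
          ENNReal.ofReal_natCast, hgd]
        ring

end TorusMap

/-! ### Probabilistic estimate -/

lemma ls_distC_self {r : ℕ} (f : TorusMap r) : distC 2 f f = 0 := by
  unfold distC; simp

lemma ls_seq_bound (a : ℕ → ℝ≥0∞) {L ρ : ℝ} {N : ℕ} (hN : 1 ≤ N) (hL : 1 ≤ L) (hρ : 0 < ρ)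
    (hρ1 : ρ < 1)
    (h1 : ∀ n, a (n + 1) ≤ ENNReal.ofReal L * a n)
    (h2 : ∀ n, a (n + N) ≤ ENNReal.ofReal ρ * a n) (n : ℕ) :
    a n ≤ ENNReal.ofReal (L ^ N * ρ⁻¹ * (ρ ^ (1 / (N : ℝ))) ^ n) * a 0 := by
  have k1 : ∀ s, a s ≤ ENNReal.ofReal (L ^ s) * a 0 := by
    intro s
    induction s with
    | zero => simp
    | succ s ih =>
      refine (h1 s).trans ?_
      rw [pow_succ, mul_comm (L ^ s), ENNReal.ofReal_mul (by linarith), mul_assoc]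
      gcongr
  have k2 : ∀ q s, a (s + N * q) ≤ ENNReal.ofReal (ρ ^ q) * a s := by
    intro q s
    induction q with
    | zero => simp
    | succ q ih =>
      have : s + N * (q + 1) = (s + N * q) + N := by ring
      rw [this]
      refine (h2 _).trans ?_
      rw [pow_succ, mul_comm (ρ ^ q), ENNReal.ofReal_mul hρ.le, mul_assoc]
      gcongr
  have hmod : n % N + N * (n / N) = n := Nat.mod_add_div n N
  have hlt : n % N < N := Nat.mod_lt _ hN
  have := k2 (n / N) (n % N)
  rw [hmod] at this
  refine this.trans ?_
  refine (mul_le_mul le_rfl (k1 _) (by positivity) (by positivity)).trans ?_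
  rw [← mul_assoc, ← ENNReal.ofReal_mul (by positivity)]
  refine mul_le_mul' (ENNReal.ofReal_le_ofReal ?_) le_rfl
  have hNr : (0:ℝ) < N := by exact_mod_cast hN
  have e1 : ρ ^ (n / N) ≤ ρ⁻¹ * (ρ ^ (1 / (N : ℝ))) ^ n := by
    rw [le_inv_mul_iff₀ hρ, ← pow_succ']
    rw [← Real.rpow_natCast, ← Real.rpow_natCast, ← Real.rpow_mul hρ.le]
    apply Real.rpow_le_rpow_of_exponent_ge hρ hρ1.le
    rw [one_div_mul_eq_div, div_le_iff₀ hNr]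
    have : n ≤ (n / N + 1) * N := by
      have : n < N * (n / N + 1) := Nat.lt_mul_div_succ n hN
      linarith
    exact_mod_cast this
  have e2 : L ^ (n % N) ≤ L ^ N := pow_le_pow_right₀ hL hlt.le
  calc ρ ^ (n / N) * L ^ (n % N) ≤ (ρ⁻¹ * (ρ ^ (1 / (N : ℝ))) ^ n) * L ^ N := by gcongr
    _ = _ := by ring

/-- The norm of the inverse derivative applied to `e`. -/
def lsR {r : ℕ} (g : TorusMap r) (e : V2) (n : ℕ) (x : T2) : ℝ := ‖g.Dninv n x e‖

/-- Contraction rates along the orbit of `y` of the direction sent to `e` at time `m`. -/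
def lsLam {r : ℕ} (g : TorusMap r) (e : V2) (m i : ℕ) (y : T2) : ℝ :=
  lsR g e (m - i) (g.toFun^[i] y) / lsR g e m y

namespace TorusMap

variable {r : ℕ} (f g : TorusMap r)

lemma ls_R_pos {e : V2} (he : e ≠ 0) (n : ℕ) (x : T2) : 0 < lsR g e n x :=
  norm_pos_iff.2 (g.ls_Dninv_ne n x e he)

lemma ls_R_cont (hr : 2 ≤ r) (e : V2) (n : ℕ) : Continuous (lsR g e n) :=
  ((g.ls_cont_Dninv hr n).clm_apply continuous_const).norm

lemma ls_lam_pos {e : V2} (he : e ≠ 0) (m i : ℕ) (x : T2) : 0 < lsLam g e m i x :=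
  div_pos (g.ls_R_pos he _ _) (g.ls_R_pos he _ _)

lemma ls_lam_cont (hr : 2 ≤ r) {e : V2} (he : e ≠ 0) (m i : ℕ) : Continuous (lsLam g e m i) :=
  ((g.ls_R_cont hr e _).comp (g.ls_cont_iter i)).div (g.ls_R_cont hr e _)
    (fun x => (g.ls_R_pos he _ x).ne')

lemma ls_Dninv_one {M : ℝ} (hg : LsNice M g) (x : T2) (v : V2) : ‖v‖ ≤ M * ‖g.Dninv 1 x v‖ := by
  have h := g.ls_Dn_inv_right 1 x v
  conv_lhs => rw [← h]
  exact hg.upper x _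

lemma ls_nstep {M : ℝ} (hr : 2 ≤ r) (hA : g.A.det ≠ 0) (hg : LsNice M g)
    {μ : Measure T2} [IsFiniteMeasure μ] (hequi : g.Equidistributed μ)
    {N : ℕ} (hN : 1 ≤ N) {t ρ : ℝ} (ht : 0 < t) (hρ : 0 < ρ) (hρ1 : ρ < 1)
    (hone : ∀ (h : T2 → ℝ≥0∞) (v : T2 → V2), (∀ x, v x ≠ 0) →
        ∫⁻ y, h (g.toFun^[N] y) * ENNReal.ofReal (‖g.Dninv N y (v (g.toFun^[N] y))‖ ^ (-t)) ∂μ ≤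
        ENNReal.ofReal ρ * ∫⁻ x, h x * ENNReal.ofReal (‖v x‖ ^ (-t)) ∂μ)
    (h : T2 → ℝ≥0∞) (v : T2 → V2) (hv : ∀ x, v x ≠ 0) (n : ℕ) :
    ∫⁻ y, h (g.toFun^[n] y) * ENNReal.ofReal (‖g.Dninv n y (v (g.toFun^[n] y))‖ ^ (-t)) ∂μ ≤
        ENNReal.ofReal ((M ^ t) ^ N * ρ⁻¹ * (ρ ^ (1 / (N : ℝ))) ^ n) *
          ∫⁻ x, h x * ENNReal.ofReal (‖v x‖ ^ (-t)) ∂μ := by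
  have hM := hg.one_le
  have hadd : ∀ n m y u, g.Dninv (n + m) y u = g.Dninv m y (g.Dninv n (g.toFun^[m] y) u) := by
    intro n m y u
    rw [g.ls_Dninv_add]
  have h0 : ∀ y, g.Dninv 0 y (v y) = v y := by
    intro y
    simp [Dninv, Dn, ← ContinuousLinearMap.one_def]
  have := ls_seq_bound (fun n => ∫⁻ y, h (g.toFun^[n] y) *
    ENNReal.ofReal (‖g.Dninv n y (v (g.toFun^[n] y))‖ ^ (-t)) ∂μ) hN
    (Real.one_le_rpow hM ht.le) hρ hρ1 ?_ ?_ n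
  · simpa only [Function.iterate_zero, id, h0] using this
  · intro n
    simp only [hadd n, Function.iterate_add_apply]
    rw [← lintegral_const_mul' _ _ ENNReal.ofReal_ne_top]
    apply g.ls_transfer hr hA hg hequi 1
    intro x s hs
    have hcard : s.card ≤ g.deg ^ 1 := by
      obtain ⟨hfin, hc⟩ := g.ls_fiber_iter hr hA 1 x
      rw [Set.ncard_eq_toFinset_card _ hfin] at hc
      refine (Finset.card_le_card ?_).trans hc
      intro y hy
      simpa using hs y hy
    have hcard' : (s.card : ℝ≥0∞) ≤ (g.deg : ℝ≥0∞) ^ 1 := by exact_mod_cast hcard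
    refine le_trans ?_ (mul_le_mul hcard' le_rfl (by positivity) (by positivity))
    rw [← nsmul_eq_mul]
    apply Finset.sum_le_card_nsmul
    intro y hy
    rw [hs y hy, mul_left_comm]
    gcongr
    rw [← ENNReal.ofReal_mul (by positivity)]
    apply ENNReal.ofReal_le_ofReal
    set w := g.Dninv n x (v (g.toFun^[n] x)) with hw
    have hwne : w ≠ 0 := g.ls_Dninv_ne _ _ _ (hv _)
    have p1 : 0 < ‖w‖ := norm_pos_iff.2 hwne
    have p2 : 0 < ‖g.Dninv 1 y w‖ := norm_pos_iff.2 (g.ls_Dninv_ne _ _ _ hwne)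
    have p3 := Real.rpow_le_rpow p1.le (g.ls_Dninv_one hg y w) ht.le
    rw [Real.mul_rpow (by linarith) p2.le] at p3
    rw [Real.rpow_neg p1.le, Real.rpow_neg p2.le, ← div_eq_mul_inv, inv_eq_one_div,
      div_le_div_iff₀ (by positivity) (by positivity), one_mul]
    exact p3
  · intro n
    simp only [hadd n, Function.iterate_add_apply]
    exact hone (fun x => h (g.toFun^[n] x)) (fun x => g.Dninv n x (v (g.toFun^[n] x)))
      (fun x => g.ls_Dninv_ne _ _ _ (hv _))

/-- the main integral bound -/
lemma ls_term {μ : Measure T2} [IsProbabilityMeasure μ] {t K κ : ℝ} (hK : 0 ≤ K) (hκ : 0 ≤ κ)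
    (h1 : ∀ (h : T2 → ℝ≥0∞) (v : T2 → V2), (∀ x, v x ≠ 0) → ∀ n,
      ∫⁻ y, h (g.toFun^[n] y) * ENNReal.ofReal (‖g.Dninv n y (v (g.toFun^[n] y))‖ ^ (-t)) ∂μ ≤
        ENNReal.ofReal (K * κ ^ n) * ∫⁻ x, h x * ENNReal.ofReal (‖v x‖ ^ (-t)) ∂μ)
    (h3 : ∀ (h : T2 → ℝ≥0∞) (v : T2 → V2), (∀ x, v x ≠ 0) → ∀ n,
      ∫⁻ y, h (g.toFun^[n] y) * ENNReal.ofReal (‖g.Dninv n y (v (g.toFun^[n] y))‖ ^ (-(3 * t))) ∂μ ≤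
        ENNReal.ofReal (K * κ ^ n) * ∫⁻ x, h x * ENNReal.ofReal (‖v x‖ ^ (-(3 * t))) ∂μ)
    {e : V2} (he : e ≠ 0) {i j m : ℕ} (hij : i ≤ j) (hjm : j ≤ m) :
    ∫⁻ y, ENNReal.ofReal ((lsLam g e m j y ^ 3 / lsLam g e m i y ^ 2) ^ t) ∂μ ≤
      ENNReal.ofReal (K ^ 2 * κ ^ j) := by
  have hadd : ∀ n m y, g.Dninv (n + m) y e = g.Dninv m y (g.Dninv n (g.toFun^[m] y) e) := by
    intro n m y
    rw [g.ls_Dninv_add]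
  have e1 : ∀ y, (lsLam g e m j y ^ 3 / lsLam g e m i y ^ 2) ^ t =
      ((lsR g e (m - j) (g.toFun^[j - i] (g.toFun^[i] y)) ^ (3 * t) *
        lsR g e (m - i) (g.toFun^[i] y) ^ (-(2 * t)))) *
        ‖g.Dninv i y (g.Dninv (m - i) (g.toFun^[i] y) e)‖ ^ (-t) := by
    intro y
    rw [← hadd, ← Function.iterate_add_apply, Nat.sub_add_cancel hij,
      Nat.sub_add_cancel (hij.trans hjm)]
    have pa := g.ls_R_pos he m y
    have pb := g.ls_R_pos he (m - i) (g.toFun^[i] y)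
    have pc := g.ls_R_pos he (m - j) (g.toFun^[j] y)
    change _ = _ * lsR g e m y ^ (-t)
    unfold lsLam
    set a := lsR g e m y
    set b := lsR g e (m - i) (g.toFun^[i] y)
    set c := lsR g e (m - j) (g.toFun^[j] y)
    have : (c / a) ^ 3 / (b / a) ^ 2 = c ^ 3 * (b ^ 2)⁻¹ * a⁻¹ := by field_simp
    rw [this, Real.mul_rpow (by positivity) (by positivity),
      Real.mul_rpow (by positivity) (by positivity), Real.inv_rpow (by positivity),
      Real.inv_rpow pa.le, Real.rpow_neg pa.le, Real.rpow_neg pb.le, Real.rpow_mul pb.le,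
      Real.rpow_mul pc.le]
    norm_num
  have e2 : ∀ x, (lsR g e (m - j) (g.toFun^[j - i] x) ^ (3 * t) *
        lsR g e (m - i) x ^ (-(2 * t))) * ‖g.Dninv (m - i) x e‖ ^ (-t) =
      lsR g e (m - j) (g.toFun^[j - i] x) ^ (3 * t) *
        ‖g.Dninv (j - i) x (g.Dninv (m - j) (g.toFun^[j - i] x) e)‖ ^ (-(3 * t)) := by
    intro x
    have : m - i = (m - j) + (j - i) := by omega
    rw [← hadd, ← this]
    have pb := g.ls_R_pos he (m - i) x
    change _ * lsR g e (m - i) x ^ (-t) = _ * lsR g e (m - i) x ^ (-(3 * t))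
    rw [mul_assoc, ← Real.rpow_add pb]
    congr 2
    ring
  calc ∫⁻ y, ENNReal.ofReal ((lsLam g e m j y ^ 3 / lsLam g e m i y ^ 2) ^ t) ∂μ
      = ∫⁻ y, (fun x => ENNReal.ofReal (lsR g e (m - j) (g.toFun^[j - i] x) ^ (3 * t) *
        lsR g e (m - i) x ^ (-(2 * t)))) (g.toFun^[i] y) *
        ENNReal.ofReal (‖g.Dninv i y ((fun x => g.Dninv (m - i) x e) (g.toFun^[i] y))‖ ^ (-t)) ∂μ := by
        apply lintegral_congr
        intro y
        rw [e1, ENNReal.ofReal_mul]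
        have pb := g.ls_R_pos he (m - i) (g.toFun^[i] y)
        have pc := g.ls_R_pos he (m - j) (g.toFun^[j - i] (g.toFun^[i] y))
        positivity
    _ ≤ ENNReal.ofReal (K * κ ^ i) * ∫⁻ x, (fun x => ENNReal.ofReal (lsR g e (m - j)
        (g.toFun^[j - i] x) ^ (3 * t) * lsR g e (m - i) x ^ (-(2 * t)))) x *
        ENNReal.ofReal (‖(fun x => g.Dninv (m - i) x e) x‖ ^ (-t)) ∂μ :=
        h1 _ _ (fun x => g.ls_Dninv_ne _ _ _ he) i
    _ = ENNReal.ofReal (K * κ ^ i) * ∫⁻ x, (fun x => ENNReal.ofReal (lsR g e (m - j) x ^ (3 * t)))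
          (g.toFun^[j - i] x) * ENNReal.ofReal (‖g.Dninv (j - i) x
            ((fun x => g.Dninv (m - j) x e) (g.toFun^[j - i] x))‖ ^ (-(3 * t))) ∂μ := by
        congr 1
        apply lintegral_congr
        intro x
        have pb := g.ls_R_pos he (m - i) x
        have pc := g.ls_R_pos he (m - j) (g.toFun^[j - i] x)
        simp only
        rw [← ENNReal.ofReal_mul (by positivity), ← ENNReal.ofReal_mul (by positivity), e2]
    _ ≤ ENNReal.ofReal (K * κ ^ i) * (ENNReal.ofReal (K * κ ^ (j - i)) *
          ∫⁻ x, (fun x => ENNReal.ofReal (lsR g e (m - j) x ^ (3 * t))) x *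
          ENNReal.ofReal (‖(fun x => g.Dninv (m - j) x e) x‖ ^ (-(3 * t))) ∂μ) := by
        gcongr
        exact h3 _ _ (fun x => g.ls_Dninv_ne _ _ _ he) (j - i)
    _ = ENNReal.ofReal (K * κ ^ i) * (ENNReal.ofReal (K * κ ^ (j - i)) * ∫⁻ x : T2, 1 ∂μ) := by
        congr 2
        apply lintegral_congr
        intro x
        have pc := g.ls_R_pos he (m - j) x
        simp only
        change _ * ENNReal.ofReal (lsR g e (m - j) x ^ _) = _
        rw [← ENNReal.ofReal_mul (by positivity), ← Real.rpow_add pc]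
        simp
    _ = _ := by
        rw [lintegral_one, measure_univ, mul_one, ← ENNReal.ofReal_mul (by positivity)]
        congr 1
        have : κ ^ j = κ ^ i * κ ^ (j - i) := by rw [← pow_add]; congr 1; omega
        rw [this]; ring

end TorusMap

lemma ls_freq_meas {α : Type*} [MeasurableSpace α] (μ : Measure α) [IsProbabilityMeasure μ]
    (A : ℕ → Set α) (hA : ∀ m, μ (A m)ᶜ ≤ 1 / 2) :
    0 < μ {y | ∃ᶠ m in atTop, y ∈ A m} := by
  set F := {y | ∃ᶠ m in atTop, y ∈ A m} with hF
  have hFc : Fᶜ = ⋃ n, ⋂ m ∈ Ici n, (A m)ᶜ := by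
    ext y
    simp [hF, Filter.not_frequently, eventually_atTop]
  have hmono : Monotone fun n => ⋂ m ∈ Ici n, (A m)ᶜ := by
    intro a b hab
    exact biInter_subset_biInter_left (Ici_subset_Ici.2 hab)
  have h1 : μ Fᶜ ≤ 1 / 2 := by
    rw [hFc, hmono.measure_iUnion]
    apply iSup_le
    intro n
    exact (measure_mono (biInter_subset_of_mem (mem_Ici.2 le_rfl))).trans (hA n)
  by_contra h0
  have h0' : μ F = 0 := by simpa using h0
  have h2 : (1 : ℝ≥0∞) ≤ μ F + μ Fᶜ := by
    rw [← measure_univ (μ := μ), ← union_compl_self F]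
    exact measure_union_le _ _
  rw [h0', zero_add] at h2
  have h3 := h2.trans h1
  have : (1 / 2 : ℝ≥0∞) < 1 := by
    rw [one_div]; exact ENNReal.inv_lt_one.2 (by norm_num)
  exact absurd h3 (not_le.2 this)

lemma ls_Q {s : ℝ} (hs : 0 < s) (hs1 : s < 1) : ∃ Q : ℝ, 1 ≤ Q ∧ ∀ m : ℕ,
    ∑ j ∈ Finset.range (m + 1), ((j : ℝ) + 1) * s ^ j ≤ Q := by
  have h1 : Summable fun j : ℕ => ((j : ℝ) + 1) * s ^ j := by
    have h2 := summable_pow_mul_geometric_of_norm_lt_one 1 (r := s) (by rwa [Real.norm_eq_abs, abs_of_pos hs])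
    have h3 := summable_geometric_of_lt_one hs.le hs1
    have := h2.add h3
    refine this.congr fun j => ?_
    ring
  refine ⟨max 1 (∑' j : ℕ, ((j : ℝ) + 1) * s ^ j), le_max_left _ _, fun m => ?_⟩
  exact (h1.sum_le_tsum _ (fun _ _ => by positivity)).trans (le_max_right _ _)

/-- The good set at time `m`. -/
def lsGood {r : ℕ} (g : TorusMap r) (K θ : ℝ) (e : V2) (m : ℕ) : Set T2 :=
  {y | ∀ j ≤ m, ∀ i ≤ j, lsLam g e m j y ^ 3 ≤ K * θ ^ j * lsLam g e m i y ^ 2}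

namespace TorusMap

variable {r : ℕ} (f g : TorusMap r)

lemma ls_markov (hr : 2 ≤ r) {μ : Measure T2} [IsProbabilityMeasure μ] {t K s Q : ℝ} (ht : 0 < t)
    (hK : 0 < K) (hs : 0 < s) (hQ1 : 1 ≤ Q)
    (hQ : ∀ m : ℕ, ∑ j ∈ Finset.range (m + 1), ((j : ℝ) + 1) * s ^ j ≤ Q)
    {e : V2} (he : e ≠ 0)
    (hterm : ∀ {i j m : ℕ}, i ≤ j → j ≤ m →
      ∫⁻ y, ENNReal.ofReal ((lsLam g e m j y ^ 3 / lsLam g e m i y ^ 2) ^ t) ∂μ ≤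
      ENNReal.ofReal (K ^ 2 * (s * s) ^ j)) (m : ℕ) :
    μ (lsGood g ((2 * K ^ 2 * Q) ^ (1 / t)) (s ^ (1 / t)) e m)ᶜ ≤ 1 / 2 := by
  set K2 := 2 * K ^ 2 * Q with hK2
  have hK2p : 0 < K2 := by positivity
  let bad : ℕ → ℕ → Set T2 := fun j i => {y | ENNReal.ofReal (K2 * s ^ j) ≤
    ENNReal.ofReal ((lsLam g e m j y ^ 3 / lsLam g e m i y ^ 2) ^ t)}
  have hbad : ∀ j ≤ m, ∀ i ≤ j, μ (bad j i) ≤ ENNReal.ofReal (1 / (2 * Q) * s ^ j) := by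
    intro j hj i hi
    have hmeas : Measurable fun y => ENNReal.ofReal ((lsLam g e m j y ^ 3 / lsLam g e m i y ^ 2) ^ t) := by
      apply ENNReal.measurable_ofReal.comp
      apply Measurable.pow_const
      exact ((g.ls_lam_cont hr he m j).measurable.pow_const 3).div
        ((g.ls_lam_cont hr he m i).measurable.pow_const 2)
    have h1 := mul_meas_ge_le_lintegral (μ := μ) hmeas (ENNReal.ofReal (K2 * s ^ j))
    have h2 := h1.trans (hterm hi hj)
    have hpos : 0 < K2 * s ^ j := by positivity
    have h3 : K ^ 2 * (s * s) ^ j = (K2 * s ^ j) * (1 / (2 * Q) * s ^ j) := by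
      rw [hK2, mul_pow]; field_simp
    rw [h3, ENNReal.ofReal_mul hpos.le] at h2
    exact (ENNReal.mul_le_mul_iff_right (by simpa using hpos) ENNReal.ofReal_ne_top).1 h2
  have hsub : (lsGood g (K2 ^ (1 / t)) (s ^ (1 / t)) e m)ᶜ ⊆
      ⋃ j ∈ Finset.range (m + 1), ⋃ i ∈ Finset.range (j + 1), bad j i := by
    intro y hy
    simp only [lsGood, mem_compl_iff, mem_setOf_eq, not_forall, not_le] at hy
    obtain ⟨j, hj, i, hi, hlt⟩ := hy
    simp only [mem_iUnion, Finset.mem_range]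
    refine ⟨j, by omega, i, by omega, ?_⟩
    apply ENNReal.ofReal_le_ofReal
    have p1 := g.ls_lam_pos he m i y
    rw [← lt_div_iff₀ (by positivity)] at hlt
    have := Real.rpow_le_rpow (by positivity) hlt.le ht.le
    refine le_trans (le_of_eq ?_) this
    have q0 : ∀ z : ℝ, 0 ≤ z → (z ^ (1 / t)) ^ t = z := by
      intro z hz
      rw [← Real.rpow_mul hz, one_div_mul_cancel ht.ne', Real.rpow_one]
    have q2 : ((s ^ (1 / t)) ^ j) ^ t = s ^ j := by
      rw [← Real.rpow_natCast, ← Real.rpow_mul (by positivity), mul_comm,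
        Real.rpow_mul (by positivity), q0 s hs.le, Real.rpow_natCast]
    rw [Real.mul_rpow (by positivity) (by positivity), q0 K2 hK2p.le, q2]
  refine (measure_mono hsub).trans ?_
  refine (measure_biUnion_finset_le _ _).trans ?_
  calc ∑ j ∈ Finset.range (m + 1), μ (⋃ i ∈ Finset.range (j + 1), bad j i)
      ≤ ∑ j ∈ Finset.range (m + 1), ENNReal.ofReal (((j : ℝ) + 1) * (1 / (2 * Q) * s ^ j)) := by
        apply Finset.sum_le_sum
        intro j hj
        refine (measure_biUnion_finset_le _ _).trans ?_
        rw [Finset.mem_range] at hj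
        refine (Finset.sum_le_card_nsmul _ _ _ (fun i hi => hbad j (by omega) i
          (by rw [Finset.mem_range] at hi; omega))).trans ?_
        rw [nsmul_eq_mul, Finset.card_range, ENNReal.ofReal_mul (p := (j : ℝ) + 1) (by positivity)]
        refine mul_le_mul' (le_of_eq ?_) le_rfl
        rw [← ENNReal.ofReal_natCast]
        simp
    _ = ENNReal.ofReal (∑ j ∈ Finset.range (m + 1), ((j : ℝ) + 1) * (1 / (2 * Q) * s ^ j)) := by
        rw [ENNReal.ofReal_sum_of_nonneg]
        intro j _
        positivity
    _ ≤ ENNReal.ofReal (1 / 2) := by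
        apply ENNReal.ofReal_le_ofReal
        have : ∑ j ∈ Finset.range (m + 1), ((j : ℝ) + 1) * (1 / (2 * Q) * s ^ j) =
          1 / (2 * Q) * ∑ j ∈ Finset.range (m + 1), ((j : ℝ) + 1) * s ^ j := by
          rw [Finset.mul_sum]
          apply Finset.sum_congr rfl
          intro j _
          ring
        rw [this]
        have h4 := hQ m
        calc _ ≤ 1 / (2 * Q) * Q := by gcongr
          _ = 1 / 2 := by field_simp
    _ = 1 / 2 := by
        rw [ENNReal.ofReal_div_of_pos (by norm_num)]; simp

lemma ls_prob (hr : 2 ≤ r) (hdeg : 2 ≤ f.deg) (hC : 0 < f.C) (hdet : 1 < ⨅ x : T2, |f.detD x|) :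
    ∃ M K θ η : ℝ, 0 < K ∧ 0 < θ ∧ θ < 1 ∧ 0 < η ∧ ∀ g : TorusMap r, distC 2 f g < η →
      LsNice M g ∧ g.A.det ≠ 0 ∧ ∀ μ : Measure T2, IsProbabilityMeasure μ → g.Equidistributed μ →
        ∀ e : V2, e ≠ 0 → 0 < μ {y | ∃ᶠ m in atTop, y ∈ lsGood g K θ e m} := by
  have hA : f.A.det ≠ 0 := by
    intro h0; unfold deg at hdeg; rw [h0] at hdeg; simp at hdeg
  obtain ⟨M, η0, hη0, hnice⟩ := f.ls_nbhd hr hdet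
  have hf : LsNice M f := (hnice f (by rw [ls_distC_self]; exact hη0)).1
  have hM := hf.one_le
  obtain ⟨N, hN, c, hc, t0, ht0, hexp⟩ := f.ls_fibre_exp hr hdeg hC
  have ht : 0 < t0 / 3 := by positivity
  obtain ⟨hx1, hx2⟩ := hexp (t0 / 3) ht (by linarith)
  obtain ⟨hy1, hy2⟩ := hexp (3 * (t0 / 3)) (by positivity) (by linarith)
  obtain ⟨ρ1, hρ1, hρ1', η1, hη1, hs1⟩ := f.ls_onestep hr hA hc ht hx1 hη0 hnice hf hx2
  obtain ⟨ρ3, hρ3, hρ3', η3, hη3, hs3⟩ := f.ls_onestep hr hA hc (by positivity) hy1 hη0 hnice hf hy2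
  set t := t0 / 3
  have hNr : (0:ℝ) < N := by exact_mod_cast hN
  set κ1 := ρ1 ^ (1 / (N : ℝ))
  set κ3 := ρ3 ^ (1 / (N : ℝ))
  have hκ1 : 0 < κ1 := by positivity
  have hκ3 : 0 < κ3 := by positivity
  have hκ1' : κ1 < 1 := Real.rpow_lt_one hρ1.le hρ1' (by positivity)
  have hκ3' : κ3 < 1 := Real.rpow_lt_one hρ3.le hρ3' (by positivity)
  set K1 := (M ^ t) ^ N * ρ1⁻¹
  set K3 := (M ^ (3 * t)) ^ N * ρ3⁻¹
  have hK1 : 0 < K1 := by positivity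
  have hK3 : 0 < K3 := by positivity
  set K := max K1 K3
  set κ := max κ1 κ3
  have hK : 0 < K := lt_max_of_lt_left hK1
  have hκ : 0 < κ := lt_max_of_lt_left hκ1
  have hκ' : κ < 1 := max_lt hκ1' hκ3'
  set s := √κ
  have hs : 0 < s := Real.sqrt_pos.2 hκ
  have hs' : s < 1 := by
    rw [Real.sqrt_lt' one_pos]; simpa using hκ'
  have hss : s * s = κ := Real.mul_self_sqrt hκ.le
  obtain ⟨Q, hQ1, hQ⟩ := ls_Q hs hs'
  refine ⟨M, (2 * K ^ 2 * Q) ^ (1 / t), s ^ (1 / t), min η0 (min η1 η3), by positivity,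
    by positivity, Real.rpow_lt_one hs.le hs' (by positivity), by positivity, fun g hg => ?_⟩
  obtain ⟨hgn, hgA⟩ := hnice g (lt_of_lt_of_le hg (min_le_left _ _))
  have hgA' : g.A.det ≠ 0 := by rw [hgA]; exact hA
  refine ⟨hgn, hgA', fun μ hμ hequi e he => ?_⟩
  apply ls_freq_meas
  have hone1 := hs1 g (lt_of_lt_of_le hg ((min_le_right _ _).trans (min_le_left _ _))) μ hμ hequi
  have hone3 := hs3 g (lt_of_lt_of_le hg ((min_le_right _ _).trans (min_le_right _ _))) μ hμ hequi
  have hn1 := fun h v hv n => g.ls_nstep hr hgA' hgn hequi hN ht hρ1 hρ1' hone1 h v hv n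
  have hn3 := fun h v hv n => g.ls_nstep hr hgA' hgn hequi hN (by positivity) hρ3 hρ3' hone3 h v hv n
  apply g.ls_markov hr ht hK hs hQ1 hQ he
  intro i j m hij hjm
  rw [hss]
  refine g.ls_term hK.le hκ.le ?_ ?_ he hij hjm
  · intro h v hv n
    refine (hn1 h v hv n).trans (mul_le_mul' (ENNReal.ofReal_le_ofReal ?_) le_rfl)
    exact mul_le_mul (le_max_left _ _) (pow_le_pow_left₀ hκ1.le (le_max_left _ _) _)
      (by positivity) hK.le
  · intro h v hv n
    refine (hn3 h v hv n).trans (mul_le_mul' (ENNReal.ofReal_le_ofReal ?_) le_rfl)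
    exact mul_le_mul (le_max_right _ _) (pow_le_pow_left₀ hκ3.le (le_max_right _ _) _)
      (by positivity) hK.le

end TorusMap

/-! ### Planar algebra -/

/-- The area form of the plane. -/
def lsW (a b : V2) : ℝ := a 0 * b 1 - a 1 * b 0

lemma ls_inner (a b : V2) : ⟪a, b⟫ = a 0 * b 0 + a 1 * b 1 := by
  simp [PiLp.inner_apply, Fin.sum_univ_two]; ring

lemma ls_normsq (a : V2) : ‖a‖ ^ 2 = a 0 ^ 2 + a 1 ^ 2 := by
  rw [← real_inner_self_eq_norm_sq, ls_inner]; ring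

/-- Rotation by a right angle. -/
def lsJ (a : V2) : V2 := !₂[-a 1, a 0]

lemma ls_normJ (a : V2) : ‖lsJ a‖ = ‖a‖ := by
  have : ‖lsJ a‖ ^ 2 = ‖a‖ ^ 2 := by
    rw [ls_normsq, ls_normsq]; simp [lsJ]; ring
  exact (sq_eq_sq₀ (norm_nonneg _) (norm_nonneg _)).1 this

lemma ls_W_inner (a b : V2) : lsW a b = ⟪lsJ a, b⟫ := by
  rw [ls_inner]; simp [lsW, lsJ]; ring

lemma ls_W_le (a b : V2) : |lsW a b| ≤ ‖a‖ * ‖b‖ := by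
  rw [ls_W_inner, ← ls_normJ a]
  exact abs_real_inner_le_norm _ _

lemma ls_W_det (L : V2 →L[ℝ] V2) (a b : V2) :
    lsW (L a) (L b) = LinearMap.det (L : V2 →ₗ[ℝ] V2) * lsW a b := by
  have hrep : ∀ v : V2, v = v 0 • EuclideanSpace.single 0 (1:ℝ) + v 1 • EuclideanSpace.single 1 (1:ℝ) := by
    intro v
    ext i
    fin_cases i <;> simp
  have hL : ∀ v : V2, ∀ i, L v i = v 0 * L (EuclideanSpace.single 0 (1:ℝ)) i +
      v 1 * L (EuclideanSpace.single 1 (1:ℝ)) i := by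
    intro v i
    conv_lhs => rw [hrep v]
    simp only [map_add, map_smul, PiLp.add_apply, PiLp.smul_apply, smul_eq_mul]
  rw [← LinearMap.det_toMatrix (EuclideanSpace.basisFun (Fin 2) ℝ).toBasis, Matrix.det_fin_two]
  simp only [LinearMap.toMatrix_apply, OrthonormalBasis.coe_toBasis, EuclideanSpace.basisFun_apply,
    OrthonormalBasis.coe_toBasis_repr_apply, EuclideanSpace.basisFun_repr,
    ContinuousLinearMap.coe_coe]
  unfold lsW
  rw [hL a 0, hL a 1, hL b 0, hL b 1]
  ring

lemma ls_decomp (a b : V2) (ha : a ≠ 0) :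
    b = (⟪a, b⟫ / ‖a‖ ^ 2) • a + (lsW a b / ‖a‖ ^ 2) • lsJ a := by
  have h : ‖a‖ ^ 2 ≠ 0 := by positivity
  rw [ls_inner]
  have h2 := ls_normsq a
  ext i
  fin_cases i
  · simp [lsJ, lsW]
    field_simp
    rw [h2]; ring
  · simp [lsJ, lsW]
    field_simp
    rw [h2]; ring

lemma ls_back {u v : ℕ → ℝ} {m : ℕ} (hm : u m ≤ 0) (h : ∀ k < m, u k ≤ u (k + 1) + v k) :
    ∀ k ≤ m, u k ≤ ∑ j ∈ Finset.Ico k m, v j := by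
  have key : ∀ d, ∀ k, k + d = m → u k ≤ ∑ j ∈ Finset.Ico k m, v j := by
    intro d
    induction d with
    | zero => intro k hk; rw [add_zero] at hk; subst hk; simpa using hm
    | succ d ih =>
      intro k hk
      have h1 : k < m := by omega
      rw [Finset.sum_eq_sum_Ico_succ_bot h1]
      linarith [h k h1, ih (k + 1) (by omega)]
  intro k hk
  exact key (m - k) k (by omega)

/-- The distortion sum. -/
def lsTheta (m : ℕ) (n : ℕ → ℝ) : ℝ :=
  ∑ i ∈ Finset.Ico 0 (m + 1), ∑ j ∈ Finset.Ico i (m + 1), n j ^ 3 / n i ^ 2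

set_option maxHeartbeats 800000 in
lemma ls_alg {M : ℝ} (hM : 1 ≤ M) {m : ℕ} (a b q : ℕ → V2) (L : ℕ → V2 →L[ℝ] V2)
    (ha : ∀ k, a (k + 1) = L k (a k)) (hb : ∀ k, b (k + 1) = L k (b k) + q k)
    (hq : ∀ k, ‖q k‖ ≤ M * ‖a k‖ ^ 2) (hdet : ∀ k, 1 ≤ |LinearMap.det (L k : V2 →ₗ[ℝ] V2)|)
    (hup : ∀ k v, ‖L k v‖ ≤ M * ‖v‖) (hlow : ∀ k v, ‖v‖ ≤ M * ‖L k v‖)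
    (ha0 : ∀ k, a k ≠ 0) (hbm : b m = 0) (k : ℕ) (hk : k ≤ m) :
    |⟪a k, b k⟫| / ‖a k‖ ^ 2 ≤ 2 * M ^ 4 * lsTheta m (fun k => ‖a k‖) ∧
    ‖b k‖ ≤ 3 * M ^ 4 * lsTheta m (fun k => ‖a k‖) * ‖a k‖ := by
  have hpos : ∀ k, 0 < ‖a k‖ := fun k => norm_pos_iff.2 (ha0 k)
  obtain ⟨T, hT⟩ : ∃ T : ℕ → ℝ, T = fun i => ∑ j ∈ Finset.Ico i (m + 1), ‖a j‖ ^ 3 / ‖a i‖ ^ 2 :=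
    ⟨_, rfl⟩
  have hTn : ∀ i, 0 ≤ T i := by
    intro i
    rw [hT]
    exact Finset.sum_nonneg fun j _ => by positivity
  have hth : lsTheta m (fun k => ‖a k‖) = ∑ i ∈ Finset.Ico 0 (m + 1), T i := by
    rw [hT]; rfl
  have hTle : ∀ i ≤ m, T i ≤ lsTheta m (fun k => ‖a k‖) := by
    intro i hi
    rw [hth]
    exact Finset.single_le_sum (f := T) (fun i _ => hTn i) (Finset.mem_Ico.2 ⟨by omega, by omega⟩)
  have hM2 : (1:ℝ) ≤ M ^ 2 := one_le_pow₀ hM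
  have hM24 : M ^ 2 ≤ M ^ 4 := pow_le_pow_right₀ hM (by norm_num)
  -- area
  have hw1 : ∀ k < m, |lsW (a k) (b k)| ≤ |lsW (a (k + 1)) (b (k + 1))| + M ^ 2 * ‖a k‖ ^ 3 := by
    intro k _
    have e1 : lsW (a (k + 1)) (b (k + 1)) =
        LinearMap.det (L k : V2 →ₗ[ℝ] V2) * lsW (a k) (b k) + lsW (a (k + 1)) (q k) := by
      rw [← ls_W_det, hb, ← ha]
      simp only [lsW, PiLp.add_apply]; ring
    have e2 : |lsW (a (k + 1)) (q k)| ≤ M ^ 2 * ‖a k‖ ^ 3 := by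
      refine (ls_W_le _ _).trans ?_
      rw [ha]
      calc _ ≤ (M * ‖a k‖) * (M * ‖a k‖ ^ 2) :=
            mul_le_mul (hup _ _) (hq k) (norm_nonneg _) (by positivity)
        _ = _ := by ring
    have e3 : |lsW (a k) (b k)| ≤ |LinearMap.det (L k : V2 →ₗ[ℝ] V2) * lsW (a k) (b k)| := by
      rw [abs_mul]
      exact le_mul_of_one_le_left (abs_nonneg _) (hdet k)
    have e4 : LinearMap.det (L k : V2 →ₗ[ℝ] V2) * lsW (a k) (b k) =
        lsW (a (k + 1)) (b (k + 1)) - lsW (a (k + 1)) (q k) := by linarith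
    rw [e4] at e3
    exact e3.trans ((abs_sub _ _).trans (by linarith))
  have hw : ∀ k ≤ m, |lsW (a k) (b k)| / ‖a k‖ ^ 2 ≤ M ^ 2 * T k := by
    intro k hk
    have h1 := ls_back (u := fun k => |lsW (a k) (b k)|) (v := fun k => M ^ 2 * ‖a k‖ ^ 3) (m := m)
      (by simp [hbm, lsW]) hw1 k hk
    have hp := hpos k
    rw [div_le_iff₀ (by positivity)]
    refine h1.trans ?_
    rw [← Finset.mul_sum, mul_assoc, hT]
    simp only [Finset.sum_mul]
    gcongr
    refine (Finset.sum_le_sum_of_subset_of_nonneg (Finset.Ico_subset_Ico_right (Nat.le_succ m))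
      (fun _ _ _ => by positivity)).trans (le_of_eq ?_)
    apply Finset.sum_congr rfl
    intro j _
    field_simp
  -- speed
  have hnT : ∀ k ≤ m, ‖a k‖ ≤ T k := by
    intro k hk
    have hp := hpos k
    have := Finset.single_le_sum (f := fun j => ‖a j‖ ^ 3 / ‖a k‖ ^ 2)
      (fun j _ => by positivity) (Finset.mem_Ico.2 ⟨le_rfl, by omega⟩ : k ∈ Finset.Ico k (m + 1))
    rw [hT]
    refine le_trans (le_of_eq ?_) this
    field_simp
  have hp1 : ∀ k < m, |⟪a k, b k⟫ / ‖a k‖ ^ 2| ≤ |⟪a (k + 1), b (k + 1)⟫ / ‖a (k + 1)‖ ^ 2| +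
      2 * M ^ 4 * T k := by
    intro k hk
    have hp := hpos k
    have hp' := hpos (k + 1)
    set P := ⟪a k, b k⟫ / ‖a k‖ ^ 2 with hP
    set W := lsW (a k) (b k) / ‖a k‖ ^ 2 with hW
    have e1 : ⟪a (k + 1), b (k + 1)⟫ = P * ‖a (k + 1)‖ ^ 2 +
        (W * ⟪a (k + 1), L k (lsJ (a k))⟫ + ⟪a (k + 1), q k⟫) := by
      rw [hb, ls_decomp (a k) (b k) (ha0 k), ← hP, ← hW, map_add, map_smul, map_smul, ← ha,
        inner_add_right, inner_add_right, real_inner_smul_right, real_inner_smul_right,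
        real_inner_self_eq_norm_sq]
      ring
    have e2 : |W * ⟪a (k + 1), L k (lsJ (a k))⟫ + ⟪a (k + 1), q k⟫| ≤
        (2 * M ^ 4 * T k) * ‖a (k + 1)‖ ^ 2 := by
      have hlk : ‖a k‖ ≤ M * ‖a (k + 1)‖ := by rw [ha]; exact hlow _ _
      have f1 : |⟪a (k + 1), L k (lsJ (a k))⟫| ≤ M ^ 2 * ‖a (k + 1)‖ ^ 2 := by
        refine (abs_real_inner_le_norm _ _).trans ?_
        have := hup k (lsJ (a k))
        rw [ls_normJ] at this
        calc _ ≤ ‖a (k + 1)‖ * (M * (M * ‖a (k + 1)‖)) := by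
              gcongr
              exact this.trans (by gcongr)
          _ = _ := by ring
      have f2 : |⟪a (k + 1), q k⟫| ≤ M ^ 2 * T k * ‖a (k + 1)‖ ^ 2 := by
        refine (abs_real_inner_le_norm _ _).trans ?_
        calc _ ≤ ‖a (k + 1)‖ * (M * (T k * (M * ‖a (k + 1)‖))) := by
              gcongr
              refine (hq k).trans ?_
              have hz : ‖a k‖ ^ 2 ≤ T k * (M * ‖a (k + 1)‖) := by
                rw [sq]
                exact mul_le_mul (hnT k hk.le) hlk (norm_nonneg _) (hTn k)
              exact mul_le_mul_of_nonneg_left hz (by linarith)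
          _ = _ := by ring
      have f3 : |W| ≤ M ^ 2 * T k := by
        rw [hW, abs_div, abs_of_pos (by positivity : 0 < ‖a k‖ ^ 2)]
        exact hw k hk.le
      refine (abs_add_le _ _).trans ?_
      rw [abs_mul]
      calc _ ≤ (M ^ 2 * T k) * (M ^ 2 * ‖a (k + 1)‖ ^ 2) + M ^ 2 * T k * ‖a (k + 1)‖ ^ 2 := by
            have := hTn k
            gcongr
        _ = (M ^ 4 + M ^ 2) * (T k * ‖a (k + 1)‖ ^ 2) := by ring
        _ ≤ (2 * M ^ 4) * (T k * ‖a (k + 1)‖ ^ 2) := by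
            have := hTn k
            gcongr
            linarith
        _ = _ := by ring
    rw [e1, add_div, mul_div_assoc, div_self (by positivity), mul_one]
    set E := (W * ⟪a (k + 1), L k (lsJ (a k))⟫ + ⟪a (k + 1), q k⟫) / ‖a (k + 1)‖ ^ 2 with hE
    have e3 : |E| ≤ 2 * M ^ 4 * T k := by
      rw [hE, abs_div, abs_of_pos (by positivity : 0 < ‖a (k + 1)‖ ^ 2),
        div_le_iff₀ (by positivity)]
      exact e2
    have : |P| ≤ |P + E| + |E| := by
      have := abs_sub (P + E) E
      simpa using this
    linarith
  have hp : |⟪a k, b k⟫| / ‖a k‖ ^ 2 ≤ 2 * M ^ 4 * lsTheta m (fun k => ‖a k‖) := by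
    have h1 := ls_back (u := fun k => |⟪a k, b k⟫ / ‖a k‖ ^ 2|) (v := fun k => 2 * M ^ 4 * T k)
      (m := m) (by simp [hbm]) hp1 k hk
    simp only [abs_div, abs_of_pos (pow_pos (hpos k) 2)] at h1
    refine h1.trans ?_
    rw [← Finset.mul_sum, hth]
    refine mul_le_mul_of_nonneg_left ?_ (by positivity)
    refine Finset.sum_le_sum_of_subset_of_nonneg (Finset.Ico_subset_Ico (Nat.zero_le _) (Nat.le_succ m))
      (fun i _ _ => hTn i)
  refine ⟨hp, ?_⟩
  have hpk := hpos k
  have hwk := hw k hk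
  rw [ls_decomp (a k) (b k) (ha0 k)]
  refine (norm_add_le _ _).trans ?_
  rw [norm_smul, norm_smul, ls_normJ, Real.norm_eq_abs, Real.norm_eq_abs, abs_div, abs_div,
    abs_of_pos (pow_pos hpk 2), ← add_mul]
  gcongr
  have h2 := hTle k hk
  have h3 := hTn k
  have : M ^ 2 * T k ≤ M ^ 4 * lsTheta m (fun k => ‖a k‖) := by gcongr
  linarith

/-! ### Distortion along the curve -/

lemma ls_theta_pos {m : ℕ} {n : ℕ → ℝ} (hn : ∀ k, 0 < n k) : 0 < lsTheta m n := by
  unfold lsTheta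
  apply Finset.sum_pos
  · intro i hi
    apply Finset.sum_pos
    · intro j _
      have := hn j
      have := hn i
      positivity
    · rw [Finset.mem_Ico] at hi
      exact ⟨i, Finset.mem_Ico.2 ⟨le_rfl, hi.2⟩⟩
  · exact ⟨0, Finset.mem_Ico.2 ⟨le_rfl, by omega⟩⟩

lemma ls_ode {m : ℕ} {C : ℝ} (hC : 0 ≤ C) (n p : ℕ → ℝ → ℝ) (hn : ∀ k s, 0 < n k s)
    (hd : ∀ k s, HasDerivAt (n k) (p k s * n k s) s)
    (hp : ∀ k ≤ m, ∀ s, |p k s| ≤ C * lsTheta m (fun k => n k s))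
    (hsmall : 10 * C * lsTheta m (fun k => n k 0) ≤ 1) (s : ℝ) (hs : s ∈ Icc (-1 : ℝ) 1) :
    lsTheta m (fun k => n k s) ≤ 2 * lsTheta m (fun k => n k 0) ∧ ∀ k ≤ m, n k s ≤ 2 * n k 0 := by
  set Θ : ℝ → ℝ := fun s => lsTheta m (fun k => n k s) with hΘ
  have hΘp : ∀ s, 0 < Θ s := fun s => ls_theta_pos fun k => hn k s
  set Θ' : ℝ → ℝ := fun s => ∑ i ∈ Finset.Ico 0 (m + 1), ∑ j ∈ Finset.Ico i (m + 1),
    (3 * p j s - 2 * p i s) * (n j s ^ 3 / n i s ^ 2) with hΘ'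
  have hΘd : ∀ s, HasDerivAt Θ (Θ' s) s := by
    intro s
    apply HasDerivAt.fun_sum
    intro i _
    apply HasDerivAt.fun_sum
    intro j _
    have h1 := ((hd j s).pow 3).div ((hd i s).pow 2) (pow_ne_zero 2 (hn i s).ne')
    have := (hn i s).ne'
    refine HasDerivAt.congr_deriv h1 ?_
    change (((3 : ℕ) : ℝ) * n j s ^ 2 * (p j s * n j s) * n i s ^ 2 -
      n j s ^ 3 * (((2 : ℕ) : ℝ) * n i s ^ 1 * (p i s * n i s))) / (n i s ^ 2) ^ 2 = _
    push_cast
    field_simp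
  have hΘb : ∀ s, |Θ' s| ≤ 5 * C * Θ s ^ 2 := by
    intro s
    have h1 : |Θ' s| ≤ ∑ i ∈ Finset.Ico 0 (m + 1), ∑ j ∈ Finset.Ico i (m + 1),
        (5 * (C * Θ s)) * (n j s ^ 3 / n i s ^ 2) := by
      refine (Finset.abs_sum_le_sum_abs _ _).trans (Finset.sum_le_sum fun i hi => ?_)
      refine (Finset.abs_sum_le_sum_abs _ _).trans (Finset.sum_le_sum fun j hj => ?_)
      rw [Finset.mem_Ico] at hi hj
      have q1 := hn i s
      have q2 := hn j s
      have q3 : 0 < n j s ^ 3 / n i s ^ 2 := by positivity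
      rw [abs_mul, abs_of_pos q3]
      refine mul_le_mul_of_nonneg_right ?_ q3.le
      have hi' := abs_le.1 (hp i (by omega) s)
      have hj' := abs_le.1 (hp j (by omega) s)
      rw [abs_le]
      constructor <;> linarith [hi'.1, hi'.2, hj'.1, hj'.2]
    refine h1.trans (le_of_eq ?_)
    simp_rw [← Finset.mul_sum]
    change 5 * (C * Θ s) * Θ s = _
    ring
  have hinv : ∀ s, ‖(Θ s)⁻¹ - (Θ 0)⁻¹‖ ≤ 5 * C * ‖s - 0‖ := by
    intro s
    refine Convex.norm_image_sub_le_of_norm_hasDerivWithin_le (s := univ) (f := fun s => (Θ s)⁻¹)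
      (f' := fun s => -Θ' s / Θ s ^ 2) ?_ ?_ convex_univ (mem_univ _) (mem_univ _)
    · intro s _
      exact ((hΘd s).fun_inv (hΘp s).ne').hasDerivWithinAt
    · intro s _
      rw [Real.norm_eq_abs, abs_div, abs_neg, abs_of_pos (pow_pos (hΘp s) 2),
        div_le_iff₀ (pow_pos (hΘp s) 2)]
      exact hΘb s
  have hΘ2 : ∀ s ∈ Icc (-1 : ℝ) 1, Θ s ≤ 2 * Θ 0 := by
    intro s hs
    have h1 := hinv s
    rw [sub_zero, Real.norm_eq_abs, Real.norm_eq_abs] at h1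
    have h2 : |s| ≤ 1 := abs_le.2 hs
    have h3 := (abs_le.1 (h1.trans (mul_le_of_le_one_right (by positivity) h2))).1
    have hp0 := hΘp 0
    have hps := hΘp s
    change 10 * C * Θ 0 ≤ 1 at hsmall
    have h4 : 5 * C ≤ (2 * Θ 0)⁻¹ := by
      rw [inv_eq_one_div, le_div_iff₀ (by positivity)]
      linarith
    have h5 : (Θ 0)⁻¹ = 2 * (2 * Θ 0)⁻¹ := by field_simp
    have h6 : (2 * Θ 0)⁻¹ ≤ (Θ s)⁻¹ := by linarith
    exact (inv_le_inv₀ (by positivity) hps).1 h6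
  refine ⟨hΘ2 s hs, fun k hk => ?_⟩
  have hlog : ‖Real.log (n k s) - Real.log (n k 0)‖ ≤ 1 / 5 * ‖s - 0‖ := by
    refine Convex.norm_image_sub_le_of_norm_hasDerivWithin_le (s := Icc (-1 : ℝ) 1)
      (f := fun s => Real.log (n k s)) (f' := fun s => p k s) ?_ ?_ (convex_Icc _ _)
      (by constructor <;> norm_num) hs
    · intro s _
      have h1 := (hd k s).log (hn k s).ne'
      rw [mul_div_cancel_right₀ _ (hn k s).ne'] at h1
      exact h1.hasDerivWithinAt
    · intro s hs
      rw [Real.norm_eq_abs]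
      refine (hp k hk s).trans ?_
      have h2 := mul_le_mul_of_nonneg_left (hΘ2 s hs) hC
      change C * Θ s ≤ _
      change 10 * C * Θ 0 ≤ 1 at hsmall
      linarith
  rw [sub_zero, Real.norm_eq_abs, Real.norm_eq_abs] at hlog
  have h2 : |s| ≤ 1 := abs_le.2 hs
  have h3 := (abs_le.1 hlog).2
  have h4 := Real.log_two_gt_d9
  have h5 : Real.log (n k s) ≤ Real.log (2 * n k 0) := by
    rw [Real.log_mul (by norm_num) (hn k 0).ne']
    linarith
  exact (Real.log_le_log_iff (hn k s) (by linarith [hn k 0])).1 h5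

/-! ### Construction of the finite time curves -/

lemma ls_theta_good {r : ℕ} (g : TorusMap r) {K θ ℓ Q : ℝ} (hK : 0 < K) (hl : 0 < ℓ)
    (hQ : ∀ m : ℕ, ∑ j ∈ Finset.range (m + 1), ((j : ℝ) + 1) * θ ^ j ≤ Q)
    {e : V2} (he : e ≠ 0) {m : ℕ} {y : T2} (hy : y ∈ lsGood g K θ e m) :
    lsTheta m (fun k => ℓ * lsLam g e m k y) ≤ ℓ * (K * Q) := by
  unfold lsTheta
  have h1 : ∑ i ∈ Finset.Ico 0 (m + 1), ∑ j ∈ Finset.Ico i (m + 1),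
      (ℓ * lsLam g e m j y) ^ 3 / (ℓ * lsLam g e m i y) ^ 2 ≤
      ∑ i ∈ Finset.Ico 0 (m + 1), ∑ j ∈ Finset.Ico i (m + 1), ℓ * (K * θ ^ j) := by
    refine Finset.sum_le_sum fun i hi => Finset.sum_le_sum fun j hj => ?_
    rw [Finset.mem_Ico] at hi hj
    have h2 := hy j (by omega) i hj.1
    have h3 := g.ls_lam_pos he m i y
    rw [div_le_iff₀ (by positivity)]
    calc (ℓ * lsLam g e m j y) ^ 3 = ℓ ^ 3 * lsLam g e m j y ^ 3 := by ring
      _ ≤ ℓ ^ 3 * (K * θ ^ j * lsLam g e m i y ^ 2) := by gcongr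
      _ = _ := by ring
  refine h1.trans ?_
  rw [Finset.sum_Ico_Ico_comm]
  have h4 : ∀ j ∈ Finset.Ico 0 (m + 1), ∑ _i ∈ Finset.Ico 0 (j + 1), ℓ * (K * θ ^ j) =
      (ℓ * K) * (((j : ℝ) + 1) * θ ^ j) := by
    intro j _
    rw [Finset.sum_const, Nat.card_Ico, nsmul_eq_mul]
    push_cast
    ring
  rw [Finset.sum_congr rfl h4, ← Finset.mul_sum, ← mul_assoc]
  have := hQ m
  rw [Finset.range_eq_Ico] at this
  gcongr

lemma ls_iterate_contDiff {S : V2 → V2} (h : ContDiff ℝ 2 S) (m : ℕ) : ContDiff ℝ 2 (S^[m]) := by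
  induction m with
  | zero => exact contDiff_id
  | succ n ih =>
    rw [Function.iterate_succ']
    exact h.comp ih

namespace TorusMap

lemma ls_curve {r : ℕ} (g : TorusMap r) (hr : 2 ≤ r) (hA : g.A.det ≠ 0) {M K θ ℓ Q : ℝ}
    (hg : LsNice M g) (hK : 0 < K) (hl : 0 < ℓ) (hQ0 : 1 ≤ Q)
    (hQ : ∀ m : ℕ, ∑ j ∈ Finset.range (m + 1), ((j : ℝ) + 1) * θ ^ j ≤ Q)
    (hsm : 120 * M ^ 4 * K * Q * ℓ ≤ 1)
    {e : V2} (he : e ≠ 0) {m : ℕ} {p : V2} (hy : proj p ∈ lsGood g K θ e m) :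
    ∃ c a b : ℝ → V2, c 0 = p ∧ (∀ s, HasDerivAt c (a s) s) ∧ (∀ s, HasDerivAt a (b s) s) ∧
      ‖a 0‖ = ℓ ∧ (∀ s ∈ Icc (-1 : ℝ) 1, ‖b s‖ ≤ ℓ / 10) ∧
      ∀ k ≤ m, ∀ s ∈ Icc (-1 : ℝ) 1, ‖g.F^[k] (c s) - g.F^[k] p‖ ≤ 2 * ℓ * K * θ ^ k := by
  obtain ⟨S, hSc, hS1, hS2⟩ := g.ls_exists_inv hr hA
  have hM := hg.one_le
  have h2r : ((2 : ℕ) : WithTop ℕ∞) ≤ (r : WithTop ℕ∞) := by exact_mod_cast hr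
  have hF2 : ContDiff ℝ 2 g.F := g.contDiff.of_le (by exact_mod_cast hr)
  have hS2c : ContDiff ℝ 2 S := hSc.of_le (by exact_mod_cast hr)
  obtain ⟨τ, hτ⟩ : ∃ τ : ℝ, τ = ℓ / lsR g e m (proj p) := ⟨_, rfl⟩
  have hRp := g.ls_R_pos he m (proj p)
  have hτp : 0 < τ := by rw [hτ]; positivity
  obtain ⟨c, hc⟩ : ∃ c : ℕ → ℝ → V2, c = fun k s =>
    g.F^[k] (S^[m] (g.F^[m] p + (s * τ) • e)) := ⟨_, rfl⟩
  have hcs : ∀ k s, c (k + 1) s = g.F (c k s) := by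
    intro k s
    rw [hc]
    exact Function.iterate_succ_apply' _ _ _
  have hc0 : ∀ k, c k 0 = g.F^[k] p := by
    intro k
    rw [hc]
    simp only [zero_mul, zero_smul, add_zero]
    rw [(Function.LeftInverse.iterate hS1 m) p]
  have hcm : ∀ s, c m s = g.F^[m] p + (s * τ) • e := by
    intro s
    rw [hc]
    exact (Function.LeftInverse.iterate hS2 m) _
  have hck : ∀ k s, c k s = g.F^[k] (c 0 s) := by
    intro k s
    rw [hc]; rfl
  have hcc : ∀ k, ContDiff ℝ 2 (c k) := by
    intro k
    induction k with
    | zero =>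
      have h1 : ContDiff ℝ 2 (S^[m]) := by
        exact ls_iterate_contDiff hS2c m
      rw [hc]
      exact h1.comp (contDiff_const.add ((contDiff_id.mul contDiff_const).smul contDiff_const))
    | succ k ih =>
      have : c (k + 1) = g.F ∘ c k := funext (hcs k)
      rw [this]
      exact hF2.comp ih
  obtain ⟨a, ha⟩ : ∃ a : ℕ → ℝ → V2, a = fun k => deriv (c k) := ⟨_, rfl⟩
  obtain ⟨b, hb⟩ : ∃ b : ℕ → ℝ → V2, b = fun k => deriv (a k) := ⟨_, rfl⟩
  have hca : ∀ k s, HasDerivAt (c k) (a k s) s := by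
    intro k s
    rw [ha]
    exact (((hcc k).differentiable (by norm_num)) s).hasDerivAt
  have hac : ∀ k, ContDiff ℝ 1 (a k) := by
    intro k
    rw [ha]
    exact ((contDiff_succ_iff_deriv (n := 1)).1 (hcc k)).2.2
  have hab : ∀ k s, HasDerivAt (a k) (b k s) s := by
    intro k s
    rw [hb]
    exact (((hac k).differentiable (by norm_num)) s).hasDerivAt
  have hFd : ∀ q, HasFDerivAt g.F (fderiv ℝ g.F q) q := fun q =>
    (hF2.differentiable (by norm_num) q).hasFDerivAt
  have hFd2 : ∀ q, HasFDerivAt (fderiv ℝ g.F) (fderiv ℝ (fderiv ℝ g.F) q) q := fun q =>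
    ((hF2.fderiv_right (m := 1) (by norm_num)).differentiable (by norm_num) q).hasFDerivAt
  have has : ∀ k s, a (k + 1) s = fderiv ℝ g.F (c k s) (a k s) := by
    intro k s
    have h1 := (hFd (c k s)).comp_hasDerivAt s (hca k s)
    have : c (k + 1) = g.F ∘ c k := funext (hcs k)
    rw [← this] at h1
    exact (hca (k + 1) s).unique h1
  have hbs : ∀ k s, b (k + 1) s = fderiv ℝ g.F (c k s) (b k s) +
      fderiv ℝ (fderiv ℝ g.F) (c k s) (a k s) (a k s) := by
    intro k s
    have h1 := (hFd2 (c k s)).comp_hasDerivAt s (hca k s)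
    have h2 := h1.clm_apply (hab k s)
    have : a (k + 1) = fun s => (fderiv ℝ g.F ∘ c k) s (a k s) := funext (has k)
    rw [← this] at h2
    rw [(hab (k + 1) s).unique h2, add_comm]
    rfl
  have ham : ∀ s, a m s = τ • e := by
    intro s
    have h1 : HasDerivAt (c m) ((1 * τ) • e) s := by
      rw [show c m = _ from funext hcm]
      exact (((hasDerivAt_id s).mul_const τ).smul_const e).const_add _
    rw [(hca m s).unique h1, one_mul]
  have hbm : ∀ s, b m s = 0 := by
    intro s
    have h1 : HasDerivAt (a m) 0 s := by
      rw [show a m = _ from funext ham]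
      exact hasDerivAt_const _ _
    exact (hab m s).unique h1
  have hτe : τ • e ≠ 0 := smul_ne_zero hτp.ne' he
  have hlow : ∀ q v, ‖v‖ ≤ M * ‖fderiv ℝ g.F q v‖ := by
    intro q v
    rw [← g.D_proj]
    exact hg.lower _ _
  have ha0 : ∀ k s, a k s ≠ 0 := by
    intro k s
    induction k with
    | zero =>
      intro h
      have : ∀ j, a j s = 0 := by
        intro j
        induction j with
        | zero => exact h
        | succ j ih => rw [has, ih, map_zero]
      exact hτe (by rw [← ham s, this m])
    | succ k ih =>
      intro h
      rw [has] at h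
      have := hlow (c k s) (a k s)
      rw [h, norm_zero, mul_zero] at this
      exact ih (norm_le_zero_iff.1 this)
  have hfwd : ∀ j k s, a (k + j) s = g.Dn j (proj (c k s)) (a k s) := by
    intro j
    induction j with
    | zero => intro k s; rfl
    | succ j ih =>
      intro k s
      rw [show k + (j + 1) = (k + 1) + j by ring, ih]
      change _ = g.Dn j (g.toFun (proj (c k s))) (g.D (proj (c k s)) (a k s))
      rw [g.toFun_proj, g.D_proj, hcs, has]
  have hnorm0 : ∀ k ≤ m, ‖a k 0‖ = ℓ * lsLam g e m k (proj p) := by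
    intro k hk
    have h1 := hfwd (m - k) k 0
    rw [show k + (m - k) = m by omega, ham, hc0, ← g.ls_iter_proj] at h1
    have h2 := congrArg (g.Dninv (m - k) (g.toFun^[k] (proj p))) h1
    rw [g.ls_Dn_inv_left, map_smul] at h2
    rw [← h2, norm_smul, Real.norm_eq_abs, abs_of_pos hτp, hτ]
    unfold lsLam
    rw [← lsR]
    ring
  have halg := fun s => ls_alg hM (m := m) (fun k => a k s) (fun k => b k s)
    (fun k => fderiv ℝ (fderiv ℝ g.F) (c k s) (a k s) (a k s)) (fun k => fderiv ℝ g.F (c k s))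
    (fun k => has k s) (fun k => hbs k s)
    (fun k => by
      refine (ContinuousLinearMap.le_opNorm₂ _ _ _).trans ?_
      have := hg.second (c k s)
      calc _ ≤ M * ‖a k s‖ * ‖a k s‖ := by gcongr
        _ = _ := by ring)
    (fun k => by
      rw [← g.D_proj]
      exact hg.det _)
    (fun k v => by
      rw [← g.D_proj]
      exact hg.upper _ _)
    (fun k v => hlow _ v) (fun k => ha0 k s) (hbm s)
  have hpos : ∀ k s, 0 < ‖a k s‖ := fun k s => norm_pos_iff.2 (ha0 k s)
  have hΘ0 : lsTheta m (fun k => ‖a k 0‖) ≤ ℓ * (K * Q) := by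
    refine le_trans (le_of_eq ?_) (ls_theta_good g hK hl hQ he hy)
    unfold lsTheta
    refine Finset.sum_congr rfl fun i hi => Finset.sum_congr rfl fun j hj => ?_
    rw [Finset.mem_Ico] at hi hj
    simp only []
    rw [hnorm0 i (by omega), hnorm0 j (by omega)]
  have hode := fun s hs => ls_ode (m := m) (C := 2 * M ^ 4) (by positivity) (fun k s => ‖a k s‖)
    (fun k s => ⟪a k s, b k s⟫ / ‖a k s‖ ^ 2) hpos
    (fun k s => by
      have h1 := (hab k s).norm_sq
      have h2 := h1.sqrt (pow_pos (hpos k s) 2).ne'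
      have h3 : (fun s => √(‖a k s‖ ^ 2)) = fun s => ‖a k s‖ :=
        funext fun s => Real.sqrt_sq (norm_nonneg _)
      rw [h3] at h2
      refine h2.congr_deriv ?_
      rw [Real.sqrt_sq (norm_nonneg _)]
      have := (hpos k s).ne'
      field_simp)
    (fun k hk s => by
      have := (halg s k hk).1
      rw [abs_div, abs_of_pos (pow_pos (hpos k s) 2)]
      exact this)
    (by
      have : 10 * (2 * M ^ 4) * (ℓ * (K * Q)) ≤ 1 := by
        have : 0 ≤ M ^ 4 * K * Q * ℓ := by positivity
        linarith
      refine le_trans ?_ this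
      gcongr) s hs
  have hlam0 : lsLam g e m 0 (proj p) = 1 := by
    unfold lsLam
    exact div_self hRp.ne'
  refine ⟨c 0, a 0, b 0, hc0 0, hca 0, hab 0, ?_, ?_, ?_⟩
  · rw [hnorm0 0 (Nat.zero_le _), hlam0, mul_one]
  · intro s hs
    have h1 := (halg s 0 (Nat.zero_le _)).2
    have h2 := (hode s hs).1
    have h3 := (hode s hs).2 0 (Nat.zero_le _)
    rw [hnorm0 0 (Nat.zero_le _), hlam0, mul_one] at h3
    have h4 : lsTheta m (fun k => ‖a k s‖) ≤ 2 * (ℓ * (K * Q)) := by linarith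
    calc ‖b 0 s‖ ≤ 3 * M ^ 4 * lsTheta m (fun k => ‖a k s‖) * ‖a 0 s‖ := h1
      _ ≤ 3 * M ^ 4 * (2 * (ℓ * (K * Q))) * (2 * ℓ) := by gcongr
      _ = (120 * M ^ 4 * K * Q * ℓ) * (ℓ / 10) := by ring
      _ ≤ 1 * (ℓ / 10) := by gcongr
      _ = _ := one_mul _
  · intro k hk s hs
    rw [← hck, ← hc0 k]
    have hlam : lsLam g e m k (proj p) ≤ K * θ ^ k := by
      have h1 := hy k hk k le_rfl
      have h2 := g.ls_lam_pos he m k (proj p)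
      have h3 : 0 < lsLam g e m k (proj p) ^ 2 := by positivity
      refine le_of_mul_le_mul_right ?_ h3
      calc _ = lsLam g e m k (proj p) ^ 3 := by ring
        _ ≤ _ := h1
    have hB : ∀ t ∈ Icc (-1 : ℝ) 1, ‖a k t‖ ≤ 2 * ℓ * K * θ ^ k := by
      intro t ht
      have h3 := (hode t ht).2 k hk
      rw [hnorm0 k hk] at h3
      calc _ ≤ _ := h3
        _ ≤ 2 * (ℓ * (K * θ ^ k)) := by gcongr
        _ = _ := by ring
    have h0 : (0 : ℝ) ∈ Icc (-1 : ℝ) 1 := by constructor <;> norm_num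
    have h5 := (convex_Icc (-1 : ℝ) 1).norm_image_sub_le_of_norm_hasDerivWithin_le
      (fun t _ => (hca k t).hasDerivWithinAt) hB h0 hs
    have h6 : ‖s - 0‖ ≤ 1 := by
      rw [sub_zero, Real.norm_eq_abs, abs_le]; exact hs
    have h7 : 0 ≤ 2 * ℓ * K * θ ^ k := (norm_nonneg _).trans (hB 0 h0)
    exact h5.trans (mul_le_of_le_one_right h7 h6)

end TorusMap

/-! ### The limit curve -/

lemma ls_ultralim (U : Ultrafilter ℕ) (f : ℕ → V2) {B : ℝ} (hB : ∀ n, ‖f n‖ ≤ B) :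
    ∃ x, Tendsto f U (𝓝 x) := by
  have h := (isCompact_closedBall (0 : V2) B).ultrafilter_le_nhds (U.map f) (by
    rw [le_principal_iff]
    change f ⁻¹' Metric.closedBall (0 : V2) B ∈ U
    refine Filter.mem_of_superset (x := univ) Filter.univ_mem (fun n _ => ?_)
    change f n ∈ Metric.closedBall (0 : V2) B
    rw [mem_closedBall_zero_iff]; exact hB n)
  obtain ⟨x, -, hx⟩ := h
  exact ⟨x, hx⟩

lemma ls_hasDerivAt {σ : ℝ → V2} {v : V2} {κ s : ℝ} (hκ : 0 < κ)
    (h : ∀ t, ‖σ t - σ s - (t - s) • v‖ ≤ κ * |t - s| ^ 2) : HasDerivAt σ v s := by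
  rw [hasDerivAt_iff_isLittleO, Asymptotics.isLittleO_iff]
  intro ε hε
  filter_upwards [Metric.ball_mem_nhds s (div_pos hε hκ)] with t ht
  rw [Metric.mem_ball, Real.dist_eq] at ht
  refine (h t).trans ?_
  rw [Real.norm_eq_abs, sq, ← mul_assoc]
  refine mul_le_mul_of_nonneg_right ?_ (abs_nonneg _)
  rw [lt_div_iff₀ hκ] at ht
  linarith

lemma ls_limit {ℓ : ℝ} (hl : 0 < ℓ) (c a b : ℕ → ℝ → V2) (p : V2) (hc0 : ∀ n, c n 0 = p)
    (hca : ∀ n s, HasDerivAt (c n) (a n s) s) (hab : ∀ n s, HasDerivAt (a n) (b n s) s)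
    (hn : ∀ n, ‖a n 0‖ = ℓ) (hb : ∀ n, ∀ s ∈ Icc (-1 : ℝ) 1, ‖b n s‖ ≤ ℓ / 10) :
    ∃ σ τ : ℝ → V2, σ 0 = p ∧ (∀ s, HasDerivAt σ (τ s) s) ∧ Continuous τ ∧ ‖τ 0‖ = ℓ ∧
      (∀ s, ‖τ s - Real.cos s • τ 0‖ ≤ ℓ / 10 * |Real.cos s|) ∧
      (∀ s t, ‖σ t - σ s - (Real.sin t - Real.sin s) • τ 0‖ ≤ ℓ / 10 * |Real.sin t - Real.sin s|) ∧
      ∀ (G : V2 → V2), Continuous G → ∀ (B : ℝ) (q : V2) (s : ℝ),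
        (∀ᶠ n in atTop, ‖G (c n (Real.sin s)) - q‖ ≤ B) → ‖G (σ s) - q‖ ≤ B := by
  have h0 : (0 : ℝ) ∈ Icc (-1 : ℝ) 1 := by constructor <;> norm_num
  have hsin : ∀ s, Real.sin s ∈ Icc (-1 : ℝ) 1 := fun s => ⟨Real.neg_one_le_sin s, Real.sin_le_one s⟩
  have e1 : ∀ n, ∀ x ∈ Icc (-1 : ℝ) 1, ‖a n x - a n 0‖ ≤ ℓ / 10 := by
    intro n x hx
    have h5 := (convex_Icc (-1 : ℝ) 1).norm_image_sub_le_of_norm_hasDerivWithin_le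
      (fun t _ => (hab n t).hasDerivWithinAt) (hb n) h0 hx
    have h6 : ‖x - 0‖ ≤ 1 := by
      rw [sub_zero, Real.norm_eq_abs, abs_le]; exact hx
    exact h5.trans (mul_le_of_le_one_right (by positivity) h6)
  have e2 : ∀ n, ∀ x ∈ Icc (-1 : ℝ) 1, ‖a n x‖ ≤ 2 * ℓ := by
    intro n x hx
    have h1 := norm_add_le (a n x - a n 0) (a n 0)
    rw [sub_add_cancel, hn] at h1
    linarith [e1 n x hx]
  have e3 : ∀ n, ∀ x ∈ Icc (-1 : ℝ) 1, ∀ y ∈ Icc (-1 : ℝ) 1,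
      ‖c n y - c n x - (y - x) • a n 0‖ ≤ ℓ / 10 * |y - x| := by
    intro n x hx y hy
    have h5 := (convex_Icc (-1 : ℝ) 1).norm_image_sub_le_of_norm_hasDerivWithin_le
      (f := fun t => c n t - t • a n 0) (f' := fun t => a n t - (1 : ℝ) • a n 0) (C := ℓ / 10)
      (fun t _ => ((hca n t).sub ((hasDerivAt_id t).smul_const _)).hasDerivWithinAt)
      (fun t ht => by rw [one_smul]; exact e1 n t ht) hx hy
    rw [Real.norm_eq_abs] at h5
    calc _ = ‖c n y - y • a n 0 - (c n x - x • a n 0)‖ := by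
          congr 1; rw [sub_smul]; abel
      _ ≤ _ := h5
  obtain ⟨τn, hτn⟩ : ∃ τn : ℕ → ℝ → V2, τn = fun n s => Real.cos s • a n (Real.sin s) := ⟨_, rfl⟩
  obtain ⟨σn, hσn⟩ : ∃ σn : ℕ → ℝ → V2, σn = fun n s => c n (Real.sin s) := ⟨_, rfl⟩
  have hτ0 : ∀ n, τn n 0 = a n 0 := by intro n; rw [hτn]; simp
  have d1 : ∀ n s, HasDerivAt (σn n) (τn n s) s := by
    intro n s
    rw [hσn, hτn]
    exact (hca n (Real.sin s)).scomp s (Real.hasDerivAt_sin s)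
  have hcos1 : ∀ s, |Real.cos s| ≤ 1 := Real.abs_cos_le_one
  have hsin1 : ∀ s, |Real.sin s| ≤ 1 := Real.abs_sin_le_one
  have d2 : ∀ n s, HasDerivAt (τn n)
      (Real.cos s • (Real.cos s • b n (Real.sin s)) + (-Real.sin s) • a n (Real.sin s)) s := by
    intro n s
    rw [hτn]
    exact (Real.hasDerivAt_cos s).smul ((hab n (Real.sin s)).scomp s (Real.hasDerivAt_sin s))
  have d3 : ∀ n s t, ‖τn n t - τn n s‖ ≤ 3 * ℓ * |t - s| := by
    intro n s t
    refine Convex.norm_image_sub_le_of_norm_hasDerivWithin_le (s := univ)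
      (fun t _ => (d2 n t).hasDerivWithinAt) (fun t _ => ?_) convex_univ (mem_univ s) (mem_univ t)
    refine (norm_add_le _ _).trans ?_
    rw [norm_smul, norm_smul, norm_smul, norm_neg, Real.norm_eq_abs, Real.norm_eq_abs]
    have h1 := hb n _ (hsin t)
    have h2 := e2 n _ (hsin t)
    have h3 : |Real.cos t| * (|Real.cos t| * ‖b n (Real.sin t)‖) ≤ 1 * (1 * (ℓ / 10)) := by
      gcongr <;> exact hcos1 t
    have h4 : |Real.sin t| * ‖a n (Real.sin t)‖ ≤ 1 * (2 * ℓ) := by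
      gcongr; exact hsin1 t
    linarith
  have d4 : ∀ n s t, ‖σn n t - σn n s - (t - s) • τn n s‖ ≤ 3 * ℓ * |t - s| ^ 2 := by
    intro n s t
    have h5 := (convex_uIcc s t).norm_image_sub_le_of_norm_hasDerivWithin_le
      (f := fun x => σn n x - x • τn n s) (f' := fun x => τn n x - (1 : ℝ) • τn n s)
      (C := 3 * ℓ * |t - s|)
      (fun x _ => ((d1 n x).sub ((hasDerivAt_id x).smul_const _)).hasDerivWithinAt)
      (fun x hx => by
        rw [one_smul]
        refine (d3 n s x).trans ?_
        have := abs_sub_left_of_mem_uIcc hx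
        gcongr) left_mem_uIcc right_mem_uIcc
    rw [Real.norm_eq_abs] at h5
    calc _ = ‖σn n t - t • τn n s - (σn n s - s • τn n s)‖ := by
          congr 1; rw [sub_smul]; abel
      _ ≤ _ := h5
      _ = _ := by ring
  have B1 : ∀ n s, ‖σn n s‖ ≤ ‖p‖ + 2 * ℓ := by
    intro n s
    have h1 := e3 n 0 h0 (Real.sin s) (hsin s)
    rw [hc0, sub_zero] at h1
    have h2 : c n (Real.sin s) = (c n (Real.sin s) - p - Real.sin s • a n 0) +
        (p + Real.sin s • a n 0) := by abel
    rw [hσn]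
    simp only
    rw [h2]
    refine (norm_add_le _ _).trans ?_
    have h3 := norm_add_le p (Real.sin s • a n 0)
    rw [norm_smul, Real.norm_eq_abs, hn] at h3
    have h4 : |Real.sin s| * ℓ ≤ 1 * ℓ := by gcongr; exact hsin1 s
    have h5 : ℓ / 10 * |Real.sin s| ≤ ℓ / 10 * 1 := by gcongr; exact hsin1 s
    linarith
  have B2 : ∀ n s, ‖τn n s‖ ≤ 2 * ℓ := by
    intro n s
    rw [hτn]
    simp only
    rw [norm_smul, Real.norm_eq_abs]
    have h2 := e2 n _ (hsin s)
    calc _ ≤ 1 * (2 * ℓ) := by gcongr; exact hcos1 s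
      _ = _ := one_mul _
  obtain ⟨U, hU⟩ : ∃ U : Ultrafilter ℕ, (U : Filter ℕ) ≤ atTop := Ultrafilter.exists_le _
  choose σ hσ using fun s => ls_ultralim U (fun n => σn n s) (fun n => B1 n s)
  choose τ hτ using fun s => ls_ultralim U (fun n => τn n s) (fun n => B2 n s)
  have lim : ∀ {f : ℕ → V2} {x : V2} {B : ℝ}, Tendsto f U (𝓝 x) → (∀ n, ‖f n‖ ≤ B) → ‖x‖ ≤ B :=
    fun h hB => le_of_tendsto h.norm (Eventually.of_forall hB)
  refine ⟨σ, τ, ?_, ?_, ?_, ?_, ?_, ?_, ?_⟩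
  · refine tendsto_nhds_unique (hσ 0) ?_
    have : (fun n => σn n 0) = fun _ => p := by
      rw [hσn]; funext n; simp [hc0]
    rw [this]
    exact tendsto_const_nhds
  · intro s
    refine ls_hasDerivAt (κ := 3 * ℓ) (by positivity) fun t => ?_
    exact lim (((hσ t).sub (hσ s)).sub ((hτ s).const_smul (t - s))) (fun n => d4 n s t)
  · have : LipschitzWith (Real.toNNReal (3 * ℓ)) τ := by
      refine LipschitzWith.of_dist_le_mul fun t s => ?_
      rw [Real.coe_toNNReal _ (by positivity), dist_eq_norm, Real.dist_eq]
      exact lim ((hτ t).sub (hτ s)) (fun n => d3 n s t)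
    exact this.continuous
  · refine tendsto_nhds_unique (hτ 0).norm ?_
    have : (fun n => ‖τn n 0‖) = fun _ => ℓ := by
      funext n; rw [hτ0, hn]
    rw [this]
    exact tendsto_const_nhds
  · intro s
    refine lim ((hτ s).sub ((hτ 0).const_smul (Real.cos s))) (fun n => ?_)
    rw [hτ0, hτn]
    simp only
    rw [← smul_sub, norm_smul, Real.norm_eq_abs, mul_comm]
    have := e1 n _ (hsin s)
    gcongr
  · intro s t
    refine lim (((hσ t).sub (hσ s)).sub ((hτ 0).const_smul (Real.sin t - Real.sin s)))
      (fun n => ?_)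
    rw [hτ0, hσn]
    exact e3 n _ (hsin s) _ (hsin t)
  · intro G hG B q s h
    have h1 := ((hG.tendsto _).comp (hσ s)).sub_const q
    refine le_of_tendsto h1.norm ?_
    rw [hσn]
    exact hU h

/-! ### Geometry of the limit curve -/

lemma ls_geom {ℓ : ℝ} (hl : 0 < ℓ) (hl1 : ℓ ≤ 1 / 100) {σ τ : ℝ → V2}
    (hd : ∀ s, HasDerivAt σ (τ s) s) (hc : Continuous τ) (hτ0 : ‖τ 0‖ = ℓ)
    (hτ : ∀ s, ‖τ s - Real.cos s • τ 0‖ ≤ ℓ / 10 * |Real.cos s|)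
    (hσ : ∀ s t, ‖σ t - σ s - (Real.sin t - Real.sin s) • τ 0‖ ≤
      ℓ / 10 * |Real.sin t - Real.sin s|) :
    IsLipGraph 1 σ 0 ∧ ℓ < clen σ ∧ ContDiff ℝ 1 σ ∧
      (∀ t ∈ Icc (-1 : ℝ) 1, deriv σ t ≠ 0) ∧
      InjOn (fun t => proj (σ t)) (Icc (-1 : ℝ) 1) := by
  have hder : deriv σ = τ := funext fun s => (hd s).deriv
  have hcos : ∀ s ∈ Icc (-1 : ℝ) 1, 0 < Real.cos s := by
    intro s hs
    apply Real.cos_pos_of_mem_Ioo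
    have := Real.pi_gt_three
    constructor <;> linarith [hs.1, hs.2]
  have hlow : ∀ s ∈ Icc (-1 : ℝ) 1, 9 / 10 * ℓ * Real.cos s ≤ ‖τ s‖ := by
    intro s hs
    have h1 := hτ s
    have h2 := hcos s hs
    have h3 : ‖Real.cos s • τ 0‖ ≤ ‖τ s‖ + ‖τ s - Real.cos s • τ 0‖ := by
      have := norm_sub_le (τ s) (τ s - Real.cos s • τ 0)
      rwa [sub_sub_cancel] at this
    rw [norm_smul, Real.norm_eq_abs, hτ0] at h3
    rw [abs_of_pos h2] at h1 h3
    linarith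
  have hsinj : ∀ s ∈ Icc (-1 : ℝ) 1, ∀ t ∈ Icc (-1 : ℝ) 1, Real.sin t - Real.sin s = 0 →
      s = t := by
    intro s hs t ht h
    have hp := Real.pi_gt_three
    refine Real.injOn_sin ?_ ?_ (sub_eq_zero.1 h).symm
    · constructor <;> linarith [hs.1, hs.2]
    · constructor <;> linarith [ht.1, ht.2]
  obtain ⟨u, hu⟩ : ∃ u : V2, u = ℓ⁻¹ • τ 0 := ⟨_, rfl⟩
  have hτu : τ 0 = ℓ • u := by rw [hu, smul_smul, mul_inv_cancel₀ hl.ne', one_smul]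
  have hu1 : ‖u‖ = 1 := by
    rw [hu, norm_smul, hτ0, norm_inv, Real.norm_eq_abs, abs_of_pos hl, inv_mul_cancel₀ hl.ne']
  have hw1 : ‖lsJ u‖ = 1 := by rw [ls_normJ, hu1]
  have huw : ⟪u, lsJ u⟫ = 0 := by rw [ls_inner]; simp [lsJ]; ring
  have hu0 : u ≠ 0 := by intro h; rw [h, norm_zero] at hu1; norm_num at hu1
  obtain ⟨x, hx⟩ : ∃ x : ℝ → ℝ, x = fun s => ⟪u, σ s - σ 0⟫ := ⟨_, rfl⟩
  obtain ⟨z, hz⟩ : ∃ z : ℝ → ℝ, z = fun s => ⟪lsJ u, σ s - σ 0⟫ := ⟨_, rfl⟩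
  have hdec : ∀ s, σ s = σ 0 + x s • u + z s • lsJ u := by
    intro s
    have h1 := ls_decomp u (σ s - σ 0) hu0
    rw [hu1, ls_W_inner, one_pow, div_one, div_one] at h1
    rw [hx, hz]
    simp only
    rw [add_assoc, ← h1]; abel
  have hxd : ∀ s t, 9 / 10 * ℓ * |Real.sin t - Real.sin s| ≤ |x t - x s| := by
    intro s t
    have h1 : ⟪u, σ t - σ s - (Real.sin t - Real.sin s) • τ 0⟫ =
        (x t - x s) - ℓ * (Real.sin t - Real.sin s) := by
      rw [hx, hτu]
      simp only [inner_sub_right, real_inner_smul_right, real_inner_self_eq_norm_sq, hu1]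
      ring
    have h2 := abs_real_inner_le_norm u (σ t - σ s - (Real.sin t - Real.sin s) • τ 0)
    rw [h1, hu1, one_mul] at h2
    have h3 := h2.trans (hσ s t)
    have h4 : |ℓ * (Real.sin t - Real.sin s)| ≤ |x t - x s| +
        |(x t - x s) - ℓ * (Real.sin t - Real.sin s)| := by
      have := abs_sub (x t - x s) ((x t - x s) - ℓ * (Real.sin t - Real.sin s))
      rwa [sub_sub_cancel] at this
    rw [abs_mul, abs_of_pos hl] at h4
    linarith
  have hzd : ∀ s t, |z t - z s| ≤ ℓ / 10 * |Real.sin t - Real.sin s| := by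
    intro s t
    have h1 : ⟪lsJ u, σ t - σ s - (Real.sin t - Real.sin s) • τ 0⟫ = z t - z s := by
      rw [hz, hτu]
      simp only [inner_sub_right, real_inner_smul_right, real_inner_comm, huw]
      ring
    have h2 := abs_real_inner_le_norm (lsJ u) (σ t - σ s - (Real.sin t - Real.sin s) • τ 0)
    rw [h1, hw1, one_mul] at h2
    exact h2.trans (hσ s t)
  have hxinj : InjOn x (Icc (-1 : ℝ) 1) := by
    intro s hs t ht h
    have h1 := hxd s t
    rw [h, sub_self, abs_zero] at h1
    apply hsinj s hs t ht
    have : |Real.sin t - Real.sin s| ≤ 0 := by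
      by_contra hh
      push Not at hh
      have : 0 < 9 / 10 * ℓ * |Real.sin t - Real.sin s| := by positivity
      linarith
    exact abs_nonpos_iff.1 this
  refine ⟨⟨u, lsJ u, fun v => z (Function.invFunOn x (Icc (-1 : ℝ) 1) v), x '' Icc (-1 : ℝ) 1,
    hu1, hw1, huw, ⟨ℓ, hl, by rw [hder, hτu]⟩, ?_, ?_⟩, ?_, ?_, ?_, ?_⟩
  · refine LipschitzOnWith.of_dist_le_mul ?_
    rintro _ ⟨s, hs, rfl⟩ _ ⟨t, ht, rfl⟩
    rw [hxinj.leftInvOn_invFunOn hs, hxinj.leftInvOn_invFunOn ht, Real.dist_eq, Real.dist_eq,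
      NNReal.coe_one, one_mul]
    have h1 := hxd t s
    have h2 := hzd t s
    have : 0 ≤ ℓ * |Real.sin s - Real.sin t| := by positivity
    linarith
  · rw [image_image]
    refine image_congr fun s hs => ?_
    beta_reduce
    rw [hxinj.leftInvOn_invFunOn hs]
    exact hdec s
  · unfold clen
    rw [hder]
    have h1 : ∫ s in (-1 : ℝ)..1, 9 / 10 * ℓ * Real.cos s ≤ ∫ s in (-1 : ℝ)..1, ‖τ s‖ :=
      intervalIntegral.integral_mono_on (by norm_num)
        ((continuous_const.mul Real.continuous_cos).intervalIntegrable _ _)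
        (hc.norm.intervalIntegrable _ _) hlow
    rw [intervalIntegral.integral_const_mul, integral_cos, Real.sin_neg] at h1
    have h2 := Real.sin_gt_sub_cube (x := 1) one_pos
    norm_num at h2
    have h3 : ℓ * (5 / 6) < ℓ * Real.sin 1 := by gcongr
    linarith
  · rw [contDiff_one_iff_deriv, hder]
    exact ⟨fun s => (hd s).differentiableAt, hc⟩
  · intro t ht h
    rw [hder] at h
    have h1 := hlow t ht
    have h2 := hcos t ht
    rw [h, norm_zero] at h1
    have : 0 < 9 / 10 * ℓ * Real.cos t := by positivity
    linarith
  · intro s hs t ht h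
    obtain ⟨m, hm⟩ := ls_proj_eq h
    have hΔ : σ t - σ s = iv m := by rw [hm]; abel
    have hnorm : ‖σ t - σ s‖ < 1 := by
      have h1 := norm_add_le (σ t - σ s - (Real.sin t - Real.sin s) • τ 0)
        ((Real.sin t - Real.sin s) • τ 0)
      rw [sub_add_cancel, norm_smul, Real.norm_eq_abs, hτ0] at h1
      have h2 := hσ s t
      have h3 : |Real.sin t - Real.sin s| ≤ 2 := by
        rw [abs_le]
        constructor <;> linarith [Real.sin_le_one s, Real.sin_le_one t, Real.neg_one_le_sin s,
          Real.neg_one_le_sin t]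
      have h4 : |Real.sin t - Real.sin s| * ℓ ≤ 2 * (1 / 100) := by gcongr
      linarith
    have hm0 : ∀ i, (iv m) i = 0 := by
      intro i
      have h1 := ls_coord_le (σ t - σ s) i
      rw [hΔ, ls_iv_apply] at h1
      rw [hΔ] at hnorm
      have h2 : |(m i : ℝ)| < 1 := h1.trans_lt hnorm
      have h3 : |m i| < 1 := by exact_mod_cast h2
      rw [ls_iv_apply, Int.abs_lt_one_iff.1 h3, Int.cast_zero]
    have hst : σ t = σ s := by
      rw [← sub_eq_zero, hΔ]
      ext i
      exact hm0 i
    apply hxinj hs ht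
    rw [hx]
    simp only
    rw [hst]

/-- Points of infinitely many good sets have a large stable manifold. -/
lemma ls_point {r : ℕ} (g : TorusMap r) (hr : 2 ≤ r) (hA : g.A.det ≠ 0) {M K θ ℓ Q : ℝ}
    (hg : LsNice M g) (hK : 0 < K) (hθ : 0 < θ) (hθ1 : θ < 1)
    (hl : 0 < ℓ) (hl1 : ℓ ≤ 1 / 100) (hQ0 : 1 ≤ Q)
    (hQ : ∀ m : ℕ, ∑ j ∈ Finset.range (m + 1), ((j : ℝ) + 1) * θ ^ j ≤ Q)
    (hsm : 120 * M ^ 4 * K * Q * ℓ ≤ 1)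
    {e : V2} (he : e ≠ 0) {y : T2} (hy : ∃ᶠ m in atTop, y ∈ lsGood g K θ e m) :
    ∃ σ : ℝ → V2, ∃ s₀ ∈ Set.Icc (-1 : ℝ) 1,
      proj (σ s₀) = y ∧ IsLipGraph 1 σ s₀ ∧ ℓ < clen σ ∧ IsStabMan g y σ := by
  obtain ⟨p, rfl⟩ := ls_proj_surj y
  obtain ⟨φ, hφ, hgood⟩ := extraction_of_frequently_atTop hy
  choose c a b hc0 hca hab hn hb hF using
    fun n => g.ls_curve hr hA hg hK hl hQ0 hQ hsm he (hgood n)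
  obtain ⟨σ, τ, hσ0, hd, hc, hτ0, hτ, hσ, hG⟩ := ls_limit hl c a b p hc0 hca hab hn hb
  obtain ⟨g1, g2, g3, g4, g5⟩ := ls_geom hl hl1 hd hc hτ0 hτ hσ
  refine ⟨σ, 0, by constructor <;> norm_num, by rw [hσ0], g1, g2, g3, g4, g5,
    max 1 (2 * ℓ * K), le_max_left _ _, -Real.log θ, ?_, ?_⟩
  · have := Real.log_neg hθ hθ1
    linarith
  · intro s _ n
    rw [g.ls_iter_proj, g.ls_iter_proj]
    refine (ls_proj_dist _ _).trans ?_
    have h1 : ‖g.F^[n] (σ s) - g.F^[n] p‖ ≤ 2 * ℓ * K * θ ^ n := by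
      refine hG (g.F^[n]) (g.ls_iter_contDiff n).continuous _ _ s ?_
      filter_upwards [eventually_ge_atTop n] with k hk
      exact hF k n (hk.trans (hφ.id_le k)) _ ⟨Real.neg_one_le_sin s, Real.sin_le_one s⟩
    have h2 : Real.exp (-(n : ℝ) * -Real.log θ) = θ ^ n := by
      rw [neg_mul_neg, Real.exp_nat_mul, Real.exp_log hθ]
    rw [h2, norm_sub_rev]
    refine h1.trans ?_
    gcongr
    exact le_max_right _ _

/-- Let `f` be a `C^r` local diffeomorphism of `𝕋²`, `r ≥ 2`, of degree
`d ≥ 2`, with `C(f) > 0` and `inf_x |det Df_x| > 1`. There are `ℓ₀ > 0` and `η > 0` such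
that for every `C^r` local diffeomorphism `g` with `d_{C²}(f,g) < η` and every
equidistributed `g`-invariant Borel probability measure `μ`, the set of points having a
local stable manifold which is a `1`-Lipschitz graph of length `> ℓ₀` has positive
`μ`-measure. -/
theorem large_stable_manifolds (r : ℕ) (hr : 2 ≤ r) (f : TorusMap r)
    (hdeg : 2 ≤ f.deg) (hC : 0 < f.C) (hdet : 1 < ⨅ x : T2, |f.detD x|) :
    ∃ ℓ₀ : ℝ, 0 < ℓ₀ ∧ ∃ η : ℝ, 0 < η ∧
      ∀ g : TorusMap r, distC 2 f g < η →
        ∀ μ : Measure T2, IsProbabilityMeasure μ → g.Invariant μ → g.Equidistributed μ →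
          0 < μ {x : T2 | ∃ σ : ℝ → V2, ∃ s₀ ∈ Set.Icc (-1 : ℝ) 1,
              proj (σ s₀) = x ∧ IsLipGraph 1 σ s₀ ∧ ℓ₀ < clen σ ∧ IsStabMan g x σ} := by
  obtain ⟨M, K, θ, η, hK, hθ, hθ1, hη, hmain⟩ := f.ls_prob hr hdeg hC hdet
  obtain ⟨Q, hQ0, hQ⟩ := ls_Q hθ hθ1
  obtain ⟨ℓ, hℓ⟩ : ∃ ℓ : ℝ, ℓ = min (1 / (120 * (max M 1) ^ 4 * K * Q)) (1 / 100) := ⟨_, rfl⟩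
  have hM1 : 1 ≤ max M 1 := le_max_right _ _
  have hDpos : 0 < 120 * (max M 1) ^ 4 * K * Q := by positivity
  have hl : 0 < ℓ := by rw [hℓ]; positivity
  refine ⟨ℓ, hl, η, hη, fun g hgf μ hμ _ hμe => ?_⟩
  obtain ⟨hg, hA, hpos⟩ := hmain g hgf
  have he : (EuclideanSpace.single (0 : Fin 2) (1 : ℝ) : V2) ≠ 0 := by
    intro h
    have := congrArg (fun v : V2 => v 0) h
    simp at this
  have hsm : 120 * M ^ 4 * K * Q * ℓ ≤ 1 := by
    have h1 : ℓ ≤ 1 / (120 * (max M 1) ^ 4 * K * Q) := by rw [hℓ]; exact min_le_left _ _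
    rw [le_div_iff₀ hDpos, max_eq_left hg.one_le] at h1
    linarith
  refine (hpos μ hμ hμe _ he).trans_le (measure_mono fun y hy => ?_)
  exact ls_point g hr hA hg hK hθ hθ1 hl (by rw [hℓ]; exact min_le_right _ _) hQ0 hQ hsm he hy

end
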